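/- arXiv:2407.16055 — 6 statements merged into one kernel-verified Lean document; each statement's English description precedes it below -/
import Mathlib

section
/- Let p, q ≥ 1 and let R = {1,…,p} × {1,…,q} be the p × q integer grid. If a subset S ⊆ R contains no rook circuit (S is WRC), then the cardinality of S is at most p + q − 1. -/
/-- A rook circuit in `S`: a cyclic sequence of `2*m ≥ 4` pairwise distinct points of `S`
such that consecutive points (cyclically) agree in exactly one coordinate, and the
coordinate of agreement alternates between the first and second coordinate. -/
def IsRookCircuit (S : Finset (ℕ × ℕ)) (m : ℕ) (c : ZMod (2 * m) → ℕ × ℕ) : Prop :=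
  2 ≤ m ∧ Function.Injective c ∧ (∀ k, c k ∈ S) ∧
    ∀ k : ZMod (2 * m),
      (Even k.val → (c k).1 = (c (k + 1)).1 ∧ (c k).2 ≠ (c (k + 1)).2) ∧
      (¬ Even k.val → (c k).2 = (c (k + 1)).2 ∧ (c k).1 ≠ (c (k + 1)).1)

/-- `S` is *without a rook circuit*. -/
def WRC (S : Finset (ℕ × ℕ)) : Prop := ¬ ∃ m c, IsRookCircuit S m c

theorem circ_of_periodic (S : Finset (ℕ × ℕ)) (m : ℕ) (hm : 2 ≤ m) (u : ℕ → ℕ)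
    (hper : ∀ k, u (k % (2 * m)) = u k)
    (he : ∀ k, k % 2 = 0 → (u (k + 1), u k) ∈ S)
    (ho : ∀ k, k % 2 = 1 → (u k, u (k + 1)) ∈ S)
    (hinj : ∀ j k, u j = u k → j % 2 = k % 2 → j % (2 * m) = k % (2 * m)) :
    ∃ m c, IsRookCircuit S m c := by
  have key : ∀ k, u k ≠ u (k + 2) := by
    intro k h
    have h1 : k ≡ k + 2 [MOD 2 * m] := hinj _ _ h (by omega)
    have h2 : 0 ≡ 2 [MOD 2 * m] := Nat.ModEq.add_left_cancel' k h1
    have h3 := (Nat.modEq_zero_iff_dvd.1 h2.symm)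
    have := Nat.le_of_dvd (by norm_num) h3
    omega
  let C : ℕ → ℕ × ℕ := fun k => if k % 2 = 0 then (u (k + 1), u k) else (u k, u (k + 1))
  have hC : ∀ k, C (k % (2 * m)) = C k := by
    intro k
    have e1 : k % (2 * m) % 2 = k % 2 := Nat.mod_mul_right_mod k 2 m
    have e2 : u (k % (2 * m) + 1) = u (k + 1) := by
      rw [← hper, ← hper (k + 1), Nat.mod_add_mod]
    simp only [C, e1, e2, hper]
  have : NeZero (2 * m) := ⟨by omega⟩
  have hsucc : ∀ k : ZMod (2 * m), C (k + 1).val = C (k.val + 1) := by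
    intro k
    rw [ZMod.val_add, ← hC (k.val + 1), ZMod.val_one'' (by omega)]
  refine ⟨m, fun k => C k.val, hm, ?_, ?_, ?_⟩
  · intro a b hab
    have ha := ZMod.val_lt a
    have hb := ZMod.val_lt b
    apply ZMod.val_injective
    change C a.val = C b.val at hab
    generalize a.val = j at *
    generalize b.val = k at *
    have main : ∀ j k, u j = u (k + 1) → u (j + 1) = u k → j % 2 ≠ k % 2 → False := by
      intro j k h1 h2 h3
      have h4 : j ≡ k + 1 [MOD 2 * m] := hinj _ _ h1 (by omega)
      have h6 : u (k + 2) = u k := by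
        rw [← h2, ← hper, ← hper (j + 1)]
        exact congrArg u (h4.add_right 1).symm
      exact key k h6.symm
    have fin : u j = u k → j % 2 = k % 2 → j = k := by
      intro h1 h2
      have := hinj j k h1 h2
      rwa [Nat.mod_eq_of_lt ha, Nat.mod_eq_of_lt hb] at this
    simp only [C] at hab
    split_ifs at hab with h1 h2 h2 <;> simp only [Prod.mk.injEq] at hab
    · exact fin hab.2 (by omega)
    · exact (main j k hab.2 hab.1 (by omega)).elim
    · exact (main j k hab.1 hab.2 (by omega)).elim
    · exact fin hab.1 (by omega)
  · intro k
    simp only [C]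
    split_ifs with h
    · exact he _ h
    · exact ho _ (by omega)
  · intro k
    simp only [hsucc]
    generalize k.val = j
    have hk := key j
    constructor
    · intro h
      have h := Nat.even_iff.1 h
      have h' : ¬ (j + 1) % 2 = 0 := by omega
      simp only [C, if_pos h, if_neg h']
      exact ⟨trivial, hk⟩
    · intro h
      have h := Nat.not_even_iff.1 h
      have h1 : ¬ j % 2 = 0 := by omega
      have h' : (j + 1) % 2 = 0 := by omega
      simp only [C, if_neg h1, if_pos h']
      exact ⟨trivial, hk⟩

theorem circ_of_walk (S : Finset (ℕ × ℕ)) (v : ℕ → ℕ)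
    (he : ∀ k, k % 2 = 0 → (v (k + 1), v k) ∈ S)
    (ho : ∀ k, k % 2 = 1 → (v k, v (k + 1)) ∈ S)
    (hnb : ∀ k, v k ≠ v (k + 2)) :
    ∃ m c, IsRookCircuit S m c := by
  classical
  have hex : ∃ n, 0 < n ∧ ∃ i, v i = v (i + 2 * n) := by
    have hfin : ∀ k, v (2 * k) ∈ S.image Prod.snd := fun k =>
      Finset.mem_image.2 ⟨_, he (2 * k) (by omega), rfl⟩
    obtain ⟨a, b, hab, h⟩ := Finite.exists_ne_map_eq_of_infinite
      (fun k : ℕ => (⟨v (2 * k), hfin k⟩ : {x // x ∈ S.image Prod.snd}))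
    have h : v (2 * a) = v (2 * b) := congrArg Subtype.val h
    rcases lt_or_gt_of_ne hab with hl | hl
    · exact ⟨b - a, by omega, 2 * a, by rw [h]; congr 1; omega⟩
    · exact ⟨a - b, by omega, 2 * b, by rw [← h]; congr 1; omega⟩
  let m := Nat.find hex
  obtain ⟨hm0, i, hi⟩ := Nat.find_spec hex
  have hmin : ∀ n, n < m → 0 < n → ∀ i, v i ≠ v (i + 2 * n) := by
    intro n hn h0 i h
    exact Nat.find_min hex hn ⟨h0, i, h⟩
  change 0 < m at hm0
  change v i = v (i + 2 * m) at hi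
  clear_value m
  have hm : 2 ≤ m := by
    by_contra hlt
    have : m = 1 := by omega
    subst this
    exact hnb i hi
  have par : ∀ k, k % (2 * m) % 2 = k % 2 := fun k => Nat.mod_mul_right_mod k 2 m
  let u : ℕ → ℕ := fun k => v (i + (k + i % 2) % (2 * m))
  have hnext : ∀ k, u (k + 1) = v (i + (k + i % 2) % (2 * m) + 1) := by
    intro k
    have hlt := Nat.mod_lt (k + i % 2) (show 2 * m > 0 by omega)
    have e : (k + 1 + i % 2) % (2 * m) = ((k + i % 2) % (2 * m) + 1) % (2 * m) := by
      rw [Nat.mod_add_mod]; congr 1; omega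
    simp only [u, e]
    by_cases h : (k + i % 2) % (2 * m) + 1 = 2 * m
    · rw [h, Nat.mod_self, add_assoc, h]; exact hi
    · rw [Nat.mod_eq_of_lt (by omega)]; rfl
  refine circ_of_periodic S m hm u ?_ ?_ ?_ ?_
  · intro k
    simp only [u, Nat.mod_add_mod]
  · intro k hk
    rw [hnext]
    have := par (k + i % 2)
    exact he _ (by omega)
  · intro k hk
    rw [hnext]
    have := par (k + i % 2)
    exact ho _ (by omega)
  · intro j k h hjk
    have p1 := par (j + i % 2)
    have p2 := par (k + i % 2)
    have l1 := Nat.mod_lt (j + i % 2) (show 2 * m > 0 by omega)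
    have l2 := Nat.mod_lt (k + i % 2) (show 2 * m > 0 by omega)
    have e : (j + i % 2) % (2 * m) = (k + i % 2) % (2 * m) := by
      simp only [u] at h
      generalize (j + i % 2) % (2 * m) = a at *
      generalize (k + i % 2) % (2 * m) = b at *
      rcases lt_trichotomy a b with hl | hl | hl
      · refine (hmin ((b - a) / 2) (by omega) (by omega) (i + a) ?_).elim
        rw [h]; congr 1; omega
      · exact hl
      · refine (hmin ((a - b) / 2) (by omega) (by omega) (i + b) ?_).elim
        rw [← h]; congr 1; omega
    exact Nat.ModEq.add_right_cancel' (i % 2) e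

theorem circ_of_min (S : Finset (ℕ × ℕ)) (hne : S.Nonempty)
    (hr : ∀ x ∈ S, ∃ y ∈ S, y.1 = x.1 ∧ y.2 ≠ x.2)
    (hc : ∀ x ∈ S, ∃ y ∈ S, y.2 = x.2 ∧ y.1 ≠ x.1) :
    ∃ m c, IsRookCircuit S m c := by
  choose! f hf hf1 hf2 using hr
  choose! g hg hg1 hg2 using hc
  obtain ⟨x0, hx0⟩ := hne
  let x : ℕ → ℕ × ℕ := fun k => Nat.rec x0 (fun k y => if k % 2 = 0 then f y else g y) k
  have hx : ∀ k, x (k + 1) = if k % 2 = 0 then f (x k) else g (x k) := fun k => rfl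
  have hxS : ∀ k, x k ∈ S := by
    intro k
    induction k with
    | zero => exact hx0
    | succ k ih =>
      rw [hx]
      split_ifs
      · exact hf _ ih
      · exact hg _ ih
  have hE : ∀ k, k % 2 = 0 → (x (k+1)).1 = (x k).1 ∧ (x (k+1)).2 ≠ (x k).2 := by
    intro k hk
    rw [hx, if_pos hk]
    exact ⟨hf1 _ (hxS k), hf2 _ (hxS k)⟩
  have hO : ∀ k, k % 2 = 1 → (x (k+1)).2 = (x k).2 ∧ (x (k+1)).1 ≠ (x k).1 := by
    intro k hk
    rw [hx, if_neg (by omega)]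
    exact ⟨hg1 _ (hxS k), hg2 _ (hxS k)⟩
  let v : ℕ → ℕ := fun k => if k % 2 = 0 then (x k).2 else (x k).1
  have v0 : ∀ k, k % 2 = 0 → v k = (x k).2 := fun k h => if_pos h
  have v1 : ∀ k, k % 2 = 1 → v k = (x k).1 := fun k h => if_neg (by omega)
  refine circ_of_walk S v ?_ ?_ ?_
  · intro k hk
    rw [v0 k hk, v1 (k+1) (by omega), (hE k hk).1]
    exact hxS k
  · intro k hk
    rw [v1 k hk, v0 (k+1) (by omega), (hO k hk).1]
    exact hxS k
  · intro k
    rcases Nat.mod_two_eq_zero_or_one k with hk | hk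
    · rw [v0 k hk, v0 (k+2) (by omega), (hO (k+1) (by omega)).1]
      exact (hE k hk).2.symm
    · rw [v1 k hk, v1 (k+2) (by omega), (hE (k+1) (by omega)).1]
      exact (hO k hk).2.symm

theorem circ_mono {S T : Finset (ℕ × ℕ)} (h : T ⊆ S)
    (hT : ∃ m c, IsRookCircuit T m c) : ∃ m c, IsRookCircuit S m c := by
  obtain ⟨m, c, h1, h2, h3, h4⟩ := hT
  exact ⟨m, c, h1, h2, fun k => h (h3 k), h4⟩

theorem circ_of_card (n : ℕ) : ∀ S : Finset (ℕ × ℕ), S.card = n → S.Nonempty →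
    (S.image Prod.fst).card + (S.image Prod.snd).card ≤ S.card →
    ∃ m c, IsRookCircuit S m c := by
  induction n with
  | zero =>
    intro S h hne
    have := hne.card_pos
    omega
  | succ n ih =>
    intro S hn hne hle
    by_cases hr : ∀ x ∈ S, ∃ y ∈ S, y.1 = x.1 ∧ y.2 ≠ x.2
    · by_cases hc : ∀ x ∈ S, ∃ y ∈ S, y.2 = x.2 ∧ y.1 ≠ x.1
      · exact circ_of_min S hne hr hc
      · push Not at hc
        obtain ⟨x, hx, h⟩ := hc
        have hcard := Finset.card_erase_of_mem hx
        have i1 : ((S.erase x).image Prod.fst).card ≤ (S.image Prod.fst).card :=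
          Finset.card_le_card (Finset.image_subset_image (Finset.erase_subset _ _))
        have i2 : ((S.erase x).image Prod.snd).card < (S.image Prod.snd).card := by
          apply Finset.card_lt_card
          refine ⟨Finset.image_subset_image (Finset.erase_subset _ _), fun hs => ?_⟩
          obtain ⟨y, hy, hyx⟩ := Finset.mem_image.1 (hs (Finset.mem_image_of_mem _ hx))
          obtain ⟨hy1, hy2⟩ := Finset.mem_erase.1 hy
          exact hy1 (Prod.ext (h y hy2 hyx) hyx)
        have p1 := (hne.image Prod.fst).card_pos
        have p2 := (hne.image Prod.snd).card_pos
        exact circ_mono (Finset.erase_subset x S) (ih _ (by omega)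
          (Finset.card_pos.1 (by omega)) (by omega))
    · push Not at hr
      obtain ⟨x, hx, h⟩ := hr
      have hcard := Finset.card_erase_of_mem hx
      have i1 : ((S.erase x).image Prod.snd).card ≤ (S.image Prod.snd).card :=
        Finset.card_le_card (Finset.image_subset_image (Finset.erase_subset _ _))
      have i2 : ((S.erase x).image Prod.fst).card < (S.image Prod.fst).card := by
        apply Finset.card_lt_card
        refine ⟨Finset.image_subset_image (Finset.erase_subset _ _), fun hs => ?_⟩
        obtain ⟨y, hy, hyx⟩ := Finset.mem_image.1 (hs (Finset.mem_image_of_mem _ hx))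
        obtain ⟨hy1, hy2⟩ := Finset.mem_erase.1 hy
        exact hy1 (Prod.ext hyx (h y hy2 hyx))
      have p1 := (hne.image Prod.fst).card_pos
      have p2 := (hne.image Prod.snd).card_pos
      exact circ_mono (Finset.erase_subset x S) (ih _ (by omega)
        (Finset.card_pos.1 (by omega)) (by omega))

/-- If `S ⊆ {1,…,p} × {1,…,q}` contains no rook circuit, then `|S| ≤ p + q - 1`. -/
theorem wrc_card_le (p q : ℕ) (hp : 1 ≤ p) (hq : 1 ≤ q) (S : Finset (ℕ × ℕ))
    (hS : S ⊆ Finset.Icc 1 p ×ˢ Finset.Icc 1 q) (hWRC : WRC S) :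
    S.card ≤ p + q - 1 := by
  by_contra hlt
  apply hWRC
  have a1 : (S.image Prod.fst).card ≤ p := by
    have : S.image Prod.fst ⊆ Finset.Icc 1 p := by
      intro a ha
      obtain ⟨y, hy, rfl⟩ := Finset.mem_image.1 ha
      exact (Finset.mem_product.1 (hS hy)).1
    simpa using Finset.card_le_card this
  have a2 : (S.image Prod.snd).card ≤ q := by
    have : S.image Prod.snd ⊆ Finset.Icc 1 q := by
      intro a ha
      obtain ⟨y, hy, rfl⟩ := Finset.mem_image.1 ha
      exact (Finset.mem_product.1 (hS hy)).2
    simpa using Finset.card_le_card this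
  exact circ_of_card _ S rfl (Finset.card_pos.1 (by omega)) (by omega)
end

section
/- Let R = {1,…,p} × {1,…,q} be the p × q integer grid and let S ⊆ R be WRC with (1,1) ∈ S. Suppose s = (i,j) ∈ S with i ≠ 1 and j ≠ 1 has exactly one of its two 'feet' (i,1), (1,j) in S; call the foot in S hot and the other one cold, denoted s''. Then S' := (S \ {s}) ∪ {s''} is again WRC. -/
lemma zval_succ {m : ℕ} (hm : 2 ≤ m) (k : ZMod (2 * m)) :
    (k + 1).val = (k.val + 1) % (2 * m) := by
  have : Fact (1 < 2 * m) := ⟨by omega⟩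
  rw [ZMod.val_add, ZMod.val_one]

lemma zeven_succ {m : ℕ} (hm : 2 ≤ m) (k : ZMod (2 * m)) :
    Even (k + 1).val ↔ ¬ Even k.val := by
  rw [zval_succ hm]
  have h : (k.val + 1) % (2 * m) % 2 = (k.val + 1) % 2 :=
    Nat.mod_mod_of_dvd _ (Dvd.intro _ rfl)
  rw [Nat.even_iff, Nat.even_iff, h]
  omega

lemma circuit_weight (S : Finset (ℕ × ℕ)) (m : ℕ) (c : ZMod (2 * m) → ℕ × ℕ)
    (h : IsRookCircuit S m c) :
    ∃ w : ℕ × ℕ → ℤ, (∃ x, w x ≠ 0) ∧ (∀ x, x ∉ S → w x = 0) ∧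
      (∀ U : Finset (ℕ × ℕ), S ⊆ U → ∀ g : ℕ → ℤ,
        ∑ x ∈ U, w x * g x.1 = 0 ∧ ∑ x ∈ U, w x * g x.2 = 0) := by
  obtain ⟨hm, hinj, hmem, hc⟩ := h
  have : NeZero (2 * m) := ⟨by omega⟩
  let e : ZMod (2 * m) → ℤ := fun k => if Even k.val then 1 else -1
  have he : ∀ k, e (k + 1) = - e k := by
    intro k
    by_cases hk : Even k.val <;> simp [e, zeven_succ hm, hk]
  refine ⟨fun x => ∑ k, if c k = x then e k else 0, ⟨c 0, ?_⟩, ?_, ?_⟩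
  · have : ∀ k, (if c k = c 0 then e k else 0) = if k = 0 then e k else 0 := by
      intro k; simp [hinj.eq_iff]
    simp only [this]
    simp [e]
  · intro x hx
    apply Finset.sum_eq_zero
    intro k _
    rw [if_neg]
    rintro rfl
    exact hx (hmem k)
  · intro U hU g
    have key : ∀ G : ℕ × ℕ → ℤ,
        ∑ x ∈ U, (∑ k, if c k = x then e k else 0) * G x = ∑ k, e k * G (c k) := by
      intro G
      simp only [Finset.sum_mul]
      rw [Finset.sum_comm]
      apply Finset.sum_congr rfl
      intro k _
      rw [Finset.sum_eq_single (c k)]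
      · simp
      · intro b _ hb
        rw [if_neg (Ne.symm hb), zero_mul]
      · intro hb; exact absurd (hU (hmem k)) hb
    have split : ∀ G : ℕ × ℕ → ℤ, ∀ P : ZMod (2 * m) → Prop, ∀ [DecidablePred P],
        (∀ k, P (k + 1) ↔ ¬ P k) → (∀ k, P k → G (c k) = G (c (k + 1))) →
        ∑ k, e k * G (c k) = 0 := by
      intro G P _ hP hG
      have h1 : ∑ k, e k * G (c k) = ∑ k, (if P k then e k * G (c k) else 0)
          + ∑ k, (if P k then 0 else e k * G (c k)) := by
        rw [← Finset.sum_add_distrib]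
        apply Finset.sum_congr rfl
        intro k _
        split_ifs <;> simp
      have h2 : ∑ k, (if P k then 0 else e k * G (c k))
          = ∑ k, (if P (k + 1) then 0 else e (k + 1) * G (c (k + 1))) :=
        (Equiv.sum_comp (Equiv.addRight (1 : ZMod (2 * m)))
          (fun k => if P k then 0 else e k * G (c k))).symm
      rw [h1, h2, ← Finset.sum_add_distrib]
      apply Finset.sum_eq_zero
      intro k _
      by_cases hk : P k
      · simp [hP, hk, he, hG k hk]
      · simp [hP, hk]
    constructor
    · rw [key (fun x => g x.1)]
      refine split (fun x => g x.1) (fun k => Even k.val) (zeven_succ hm) ?_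
      intro k hk
      rw [((hc k).1 hk).1]
    · rw [key (fun x => g x.2)]
      refine split (fun x => g x.2) (fun k => ¬ Even k.val) ?_ ?_
      · intro k; rw [zeven_succ hm]
      · intro k hk
        rw [((hc k).2 hk).1]

lemma walk_circuit (S : Finset (ℕ × ℕ)) (x : ℕ → ℕ × ℕ) (hx : ∀ n, x n ∈ S)
    (h0 : ∀ n, Even n → (x n).1 = (x (n + 1)).1 ∧ (x n).2 ≠ (x (n + 1)).2)
    (h1 : ∀ n, ¬ Even n → (x n).2 = (x (n + 1)).2 ∧ (x n).1 ≠ (x (n + 1)).1) :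
    ∃ m c, IsRookCircuit S m c := by
  classical
  -- repetition
  let Q : ℕ → Prop := fun d => 0 < d ∧ Even d ∧
    ∃ a, (Even a ∧ (x a).1 = (x (a + d)).1) ∨ (¬ Even a ∧ (x a).2 = (x (a + d)).2)
  have hex : ∃ d, Q d := by
    have : ∃ a b : ℕ, a < b ∧ x (2 * a) = x (2 * b) := by
      by_contra hcon
      push Not at hcon
      have hinj : Function.Injective (fun n => (⟨x (2 * n), hx _⟩ : S)) := by
        intro a b hab
        have hab' : x (2 * a) = x (2 * b) := congrArg Subtype.val hab
        rcases lt_trichotomy a b with h | h | h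
        · exact absurd hab' (hcon a b h)
        · exact h
        · exact absurd hab'.symm (hcon b a h)
      exact not_injective_infinite_finite _ hinj
    obtain ⟨a, b, hab, hxx⟩ := this
    refine ⟨2 * (b - a), by omega, by simp, 2 * a, Or.inl ⟨by simp, ?_⟩⟩
    rw [hxx]; congr 2; omega
  obtain ⟨hd, hde, a, ha⟩ := Nat.find_spec hex
  have hmin : ∀ e, e < Nat.find hex → ¬ Q e := fun e he => Nat.find_min hex he
  generalize Nat.find hex = d at *
  have hne : ∀ n, x n ≠ x (n + 1) := by
    intro n hn
    by_cases h : Even n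
    · exact (h0 n h).2 (by rw [← hn])
    · exact (h1 n h).2 (by rw [← hn])
  have hd4 : 4 ≤ d := by
    by_contra hlt
    have : d = 2 := by
      rcases hde with ⟨r, hr⟩; omega
    subst this
    rcases ha with ⟨hae, hu⟩ | ⟨hae, hu⟩
    · have hb := h1 (a + 1) (by simpa [Nat.even_add_one] using hae)
      exact hb.2 ((h0 a hae).1.symm.trans hu)
    · have hb := h0 (a + 1) (by simpa [Nat.even_add_one] using hae)
      exact hb.2 ((h1 a hae).1.symm.trans hu)
  have hdist : ∀ k l, k < l → l < k + d → x k ≠ x l := by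
    intro k l hkl hld hxx
    by_cases hp : Even (l - k)
    · refine hmin (l - k) (by omega) ⟨by omega, hp, k, ?_⟩
      have : k + (l - k) = l := by omega
      rw [this, hxx]
      by_cases hk : Even k <;> simp [hk]
    · obtain ⟨l', rfl⟩ : ∃ l', l = l' + 1 := ⟨l - 1, by omega⟩
      rcases Nat.eq_or_lt_of_le (Nat.lt_succ_iff.mp hkl) with h | h
      · subst h; exact hne k hxx
      · have hpe : Even (l' - k) := by
          have : l' + 1 - k = (l' - k) + 1 := by omega
          rw [this, Nat.even_add_one] at hp
          exact not_not.mp hp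
        refine hmin (l' - k) (by omega) ⟨by omega, hpe, k, ?_⟩
        have e1 : k + (l' - k) = l' := by omega
        have hpar : Even l' ↔ Even k := by
          rw [← e1, Nat.even_add]; simp [hpe]
        rw [e1]
        by_cases hk : Even k
        · left; refine ⟨hk, ?_⟩
          rw [hxx, (h0 l' (hpar.2 hk)).1]
        · right; refine ⟨hk, ?_⟩
          rw [hxx, (h1 l' (fun h => hk (hpar.1 h))).1]
  -- periodic sequence
  obtain ⟨m, rfl⟩ : ∃ m, d = 2 * m := by
    rcases hde with ⟨r, hr⟩; exact ⟨r, by omega⟩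
  have hm : 2 ≤ m := by omega
  let y : ℕ → ℕ × ℕ := fun n => x (a + 1 + n % (2 * m))
  have hyinj : ∀ k l, y k = y l → k % (2 * m) = l % (2 * m) := by
    intro k l hkl
    have hk := Nat.mod_lt k hd
    have hl := Nat.mod_lt l hd
    by_contra hcon
    rcases Nat.lt_or_gt_of_ne hcon with h | h
    · exact hdist _ _ (by omega) (by omega) hkl
    · exact hdist _ _ (by omega) (by omega) hkl.symm
  have hyne : ∀ n, y n ≠ y (n + 1) := by
    intro n hn
    have := hyinj _ _ hn
    have h2 : n ≡ n + 1 [MOD 2 * m] := this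
    have h3 : 0 ≡ 1 [MOD 2 * m] := Nat.ModEq.add_left_cancel' n h2
    have : 0 % (2 * m) = 1 % (2 * m) := h3
    rw [Nat.zero_mod, Nat.mod_eq_of_lt (by omega)] at this
    omega
  have hmod2 : ∀ n, n % (2 * m) % 2 = n % 2 := fun n =>
    Nat.mod_mod_of_dvd _ (Dvd.intro _ rfl)
  have hsucc : ∀ n, (n % (2 * m) + 1 < 2 * m ∧ (n + 1) % (2 * m) = n % (2 * m) + 1) ∨
      (n % (2 * m) + 1 = 2 * m ∧ (n + 1) % (2 * m) = 0) := by
    intro n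
    have := Nat.mod_lt n hd
    rcases Nat.lt_or_ge (n % (2 * m) + 1) (2 * m) with h | h
    · left; refine ⟨h, ?_⟩
      rw [Nat.add_mod, Nat.mod_eq_of_lt (show 1 < 2 * m by omega), Nat.mod_eq_of_lt h]
    · right; refine ⟨by omega, ?_⟩
      rw [Nat.add_mod, Nat.mod_eq_of_lt (show 1 < 2 * m by omega)]
      have : n % (2 * m) + 1 = 2 * m := by omega
      rw [this, Nat.mod_self]
  have hy1 : ∀ n, Even (a + 1 + n) → (y n).1 = (y (n + 1)).1 := by
    intro n hn
    have hm2 := hmod2 n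
    have hpar : Even (a + 1 + n % (2 * m)) := by rw [Nat.even_iff] at *; omega
    rcases hsucc n with ⟨_, h⟩ | ⟨h', h⟩
    · simp only [y, h]; exact (h0 _ hpar).1
    · simp only [y, h]
      have hae : Even a := by rw [Nat.even_iff] at *; omega
      have hh : (x a).1 = (x (a + 2 * m)).1 := by
        rcases ha with h | h
        · exact h.2
        · exact absurd hae h.1
      have e1 : a + 1 + n % (2 * m) = a + 2 * m := by omega
      rw [e1, ← hh]; exact (h0 a hae).1
  have hy2 : ∀ n, ¬ Even (a + 1 + n) → (y n).2 = (y (n + 1)).2 := by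
    intro n hn
    have hm2 := hmod2 n
    have hpar : ¬ Even (a + 1 + n % (2 * m)) := by rw [Nat.even_iff] at *; omega
    rcases hsucc n with ⟨_, h⟩ | ⟨h', h⟩
    · simp only [y, h]; exact (h1 _ hpar).1
    · simp only [y, h]
      have hae : ¬ Even a := by rw [Nat.even_iff] at *; omega
      have hh : (x a).2 = (x (a + 2 * m)).2 := by
        rcases ha with h | h
        · exact absurd h.1 hae
        · exact h.2
      have e1 : a + 1 + n % (2 * m) = a + 2 * m := by omega
      rw [e1, ← hh]; exact (h1 a hae).1
  have : NeZero (2 * m) := ⟨by omega⟩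
  have hper : ∀ k l, k % (2 * m) = l % (2 * m) → y k = y l := by
    intro k l h; simp only [y, h]
  have hstep : ∀ k : ZMod (2 * m), y ((k + 1).val + (a + 1)) = y (k.val + (a + 1) + 1) := by
    intro k
    apply hper
    rw [zval_succ hm, Nat.mod_add_mod]
    congr 1; omega
  refine ⟨m, fun k => y (k.val + (a + 1)), hm, ?_, ?_, ?_⟩
  · intro k l hkl
    have h2 : k.val + (a + 1) ≡ l.val + (a + 1) [MOD 2 * m] := hyinj _ _ hkl
    have h3 : k.val % (2 * m) = l.val % (2 * m) := Nat.ModEq.add_right_cancel' _ h2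
    rw [Nat.mod_eq_of_lt (ZMod.val_lt k), Nat.mod_eq_of_lt (ZMod.val_lt l)] at h3
    exact ZMod.val_injective _ h3
  · intro k; exact hx _
  · intro k
    simp only [hstep]
    have hn := hyne (k.val + (a + 1))
    constructor
    · intro hk
      have e := hy1 (k.val + (a + 1)) (by rw [Nat.even_iff] at *; omega)
      exact ⟨e, fun e2 => hn (Prod.ext e e2)⟩
    · intro hk
      have e := hy2 (k.val + (a + 1)) (by rw [Nat.even_iff] at *; omega)
      exact ⟨e, fun e2 => hn (Prod.ext e2 e)⟩

lemma weight_circuit (S U : Finset (ℕ × ℕ)) (hSU : S ⊆ U) (w : ℕ × ℕ → ℤ) (hne : ∃ x, w x ≠ 0)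
    (hsupp : ∀ x, x ∉ S → w x = 0)
    (hsum : ∀ g : ℕ → ℤ, ∑ x ∈ U, w x * g x.1 = 0 ∧ ∑ x ∈ U, w x * g x.2 = 0) :
    ∃ m c, IsRookCircuit S m c := by
  classical
  have hin : ∀ x, w x ≠ 0 → x ∈ S := fun x h => by
    by_contra h'; exact h (hsupp x h')
  have hr : ∀ x : {x // w x ≠ 0}, ∃ y : {x // w x ≠ 0}, x.1.1 = y.1.1 ∧ x.1.2 ≠ y.1.2 := by
    rintro ⟨x, hx⟩
    by_contra! hcon
    have := (hsum (fun r => if r = x.1 then 1 else 0)).1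
    rw [Finset.sum_eq_single x] at this
    · simp at this; exact hx this
    · intro b _ hb
      by_cases h : b.1 = x.1
      · by_cases hw : w b = 0
        · simp [hw]
        · exact absurd (Prod.ext h (hcon ⟨b, hw⟩ h.symm).symm) hb
      · simp [h]
    · intro h; exact absurd (hSU (hin x hx)) h
  have hc : ∀ x : {x // w x ≠ 0}, ∃ y : {x // w x ≠ 0}, x.1.2 = y.1.2 ∧ x.1.1 ≠ y.1.1 := by
    rintro ⟨x, hx⟩
    by_contra! hcon
    have := (hsum (fun r => if r = x.2 then 1 else 0)).2
    rw [Finset.sum_eq_single x] at this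
    · simp at this; exact hx this
    · intro b _ hb
      by_cases h : b.2 = x.2
      · by_cases hw : w b = 0
        · simp [hw]
        · exact absurd (Prod.ext (hcon ⟨b, hw⟩ h.symm).symm h) hb
      · simp [h]
    · intro h; exact absurd (hSU (hin x hx)) h
  choose f hf using hr
  choose g hg using hc
  obtain ⟨x0, hx0⟩ := hne
  let X : ℕ → {x // w x ≠ 0} := fun n =>
    Nat.rec ⟨x0, hx0⟩ (fun n p => if Even n then f p else g p) n
  have hX : ∀ n, X (n + 1) = if Even n then f (X n) else g (X n) := fun n => rfl
  refine walk_circuit S (fun n => (X n).1) (fun n => hin _ (X n).2) ?_ ?_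
  · intro n hn
    simp only [hX, if_pos hn]; exact hf _
  · intro n hn
    simp only [hX, if_neg hn]; exact hg _

lemma exchange_aux (S : Finset (ℕ × ℕ)) (hWRC : WRC S)
    (s hot cold o : ℕ × ℕ) (hs : s ∈ S) (hhot : hot ∈ S) (ho : o ∈ S) (hcold : cold ∉ S)
    (hsh : s ≠ hot) (hso : s ≠ o)
    (hbal : ∀ g : ℕ → ℤ, g cold.1 - g s.1 + g hot.1 - g o.1 = 0 ∧
      g cold.2 - g s.2 + g hot.2 - g o.2 = 0) :
    WRC (insert cold (S \ {s})) := by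
  classical
  rintro ⟨m, c, hc⟩
  obtain ⟨w, ⟨x0, hx0⟩, hsupp, hsum⟩ := circuit_weight _ m c hc
  have hsc : s ≠ cold := by rintro rfl; exact hcold hs
  have hws : w s = 0 := hsupp s (by simp [hsc])
  let dl : ℕ × ℕ → ℕ × ℕ → ℤ := fun p x => if x = p then 1 else 0
  let q : ℕ × ℕ → ℤ := fun x => dl cold x - dl s x + dl hot x - dl o x
  have hch : cold ≠ hot := by rintro rfl; exact hcold hhot
  have hco : cold ≠ o := by rintro rfl; exact hcold ho
  have hqc : q cold = 1 := by simp [q, dl, hsc.symm, hch, hco]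
  have hqs : q s = -1 := by simp [q, dl, hsc, hsh, hso]
  apply hWRC
  refine weight_circuit S (insert cold S) (Finset.subset_insert _ _)
    (fun x => w x - w cold * q x) ?_ ?_ ?_
  · by_cases h : w cold = 0
    · exact ⟨x0, by simpa [h] using hx0⟩
    · exact ⟨s, by simpa [hws, hqs] using h⟩
  · intro x hx
    by_cases h : x = cold
    · subst h; simp [hqc]
    · have h1 : w x = 0 := hsupp x (by simp [h, hx])
      have h2 : x ≠ s := by rintro rfl; exact hx hs
      have h3 : x ≠ hot := by rintro rfl; exact hx hhot
      have h4 : x ≠ o := by rintro rfl; exact hx ho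
      simp [h1, q, dl, h, h2, h3, h4]
  · intro g
    have hd : ∀ (G : ℕ × ℕ → ℤ) (p : ℕ × ℕ), p ∈ insert cold S →
        ∑ x ∈ insert cold S, dl p x * G x = G p := by
      intro G p hp
      simp only [dl, ite_mul, one_mul, zero_mul]
      rw [Finset.sum_ite_eq' _ p G, if_pos hp]
    have hq : ∀ G : ℕ × ℕ → ℤ, ∑ x ∈ insert cold S, q x * G x
        = G cold - G s + G hot - G o := by
      intro G
      simp only [q, sub_mul, add_mul, Finset.sum_sub_distrib, Finset.sum_add_distrib]
      rw [hd G cold (by simp), hd G s (by simp [hs]), hd G hot (by simp [hhot]),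
        hd G o (by simp [ho])]
    have hw := hsum (insert cold S)
      (Finset.insert_subset_insert _ Finset.sdiff_subset) g
    constructor
    · simp only [sub_mul, Finset.sum_sub_distrib, mul_assoc, ← Finset.mul_sum]
      rw [hw.1, hq (fun x => g x.1), (hbal g).1]; simp
    · simp only [sub_mul, Finset.sum_sub_distrib, mul_assoc, ← Finset.mul_sum]
      rw [hw.2, hq (fun x => g x.2), (hbal g).2]; simp

/-- If `S` is WRC with `(1,1) ∈ S`, and `s = (i,j) ∈ S` (with `i ≠ 1`, `j ≠ 1`) has exactly
one of its feet `(i,1)`, `(1,j)` in `S` (the `hot` one, the other being the `cold` foot),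
then `(S \ {s}) ∪ {cold}` is again WRC. -/
theorem wrc_hot_foot_exchange (p q : ℕ) (S : Finset (ℕ × ℕ))
    (hS : S ⊆ Finset.Icc 1 p ×ˢ Finset.Icc 1 q) (hWRC : WRC S)
    (h11 : (1, 1) ∈ S) (i j : ℕ) (hs : (i, j) ∈ S) (hi : i ≠ 1) (hj : j ≠ 1)
    (hot cold : ℕ × ℕ) (hfeet : ({hot, cold} : Finset (ℕ × ℕ)) = {(i, 1), (1, j)})
    (hhot : hot ∈ S) (hcold : cold ∉ S) :
    WRC (insert cold (S \ {(i, j)})) := by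
  have hne : ((i, 1) : ℕ × ℕ) ≠ (1, j) := fun h => hi (congrArg Prod.fst h)
  have hcases : (hot = (i, 1) ∧ cold = (1, j)) ∨ (hot = (1, j) ∧ cold = (i, 1)) := by
    have hh : hot ∈ ({(i, 1), (1, j)} : Finset (ℕ × ℕ)) := by rw [← hfeet]; simp
    have hc : cold ∈ ({(i, 1), (1, j)} : Finset (ℕ × ℕ)) := by rw [← hfeet]; simp
    have hhc : hot ≠ cold := by rintro rfl; exact hcold hhot
    simp only [Finset.mem_insert, Finset.mem_singleton] at hh hc
    rcases hh with rfl | rfl <;> rcases hc with rfl | rfl <;> simp_all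
  apply exchange_aux S hWRC (i, j) hot cold (1, 1) hs hhot h11 hcold
  · rcases hcases with ⟨rfl, _⟩ | ⟨rfl, _⟩ <;> simp [hi, hj]
  · simp [hi]
  · intro g
    rcases hcases with ⟨rfl, rfl⟩ | ⟨rfl, rfl⟩ <;> constructor <;> simp only <;> ring
end

section
/- Let R = {1,…,p} × {1,…,q} be the p × q integer grid and S ⊆ R. Then S contains a rook circuit if and only if there exists a function μ : S → ℝ, not identically zero, all of whose row sums and column sums vanish; that is, for every i ∈ {1,…,p} the sum of μ over points of S with first coordinate i is 0, and for every j ∈ {1,…,q} the sum of μ over points of S with second coordinate j is 0. -/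
theorem rc_val_succ (m : ℕ) (hm : 2 ≤ m) (k : ZMod (2 * m)) :
    k.val < 2 * m ∧ ((k.val + 1 < 2 * m ∧ (k + 1).val = k.val + 1) ∨
      (k.val + 1 = 2 * m ∧ (k + 1).val = 0)) := by
  have : NeZero (2 * m) := ⟨by omega⟩
  have : Fact (1 < 2 * m) := ⟨by omega⟩
  have h := ZMod.val_lt k
  refine ⟨h, ?_⟩
  rw [ZMod.val_add, ZMod.val_one]
  rcases Nat.lt_or_ge (k.val + 1) (2 * m) with h1 | h1
  · left; exact ⟨h1, Nat.mod_eq_of_lt h1⟩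
  · right
    have : k.val + 1 = 2 * m := by omega
    exact ⟨this, by rw [this]; simp⟩

theorem rc_even_succ (m : ℕ) (hm : 2 ≤ m) (k : ZMod (2 * m)) :
    Even (k + 1).val ↔ ¬ Even k.val := by
  have := rc_val_succ m hm k
  grind

/-- alternating sums vanish -/
theorem rc_alt (m : ℕ) (hm : 2 ≤ m) [NeZero (2 * m)] (F : ZMod (2 * m) → ℝ)
    (hF : (∀ k : ZMod (2 * m), Even k.val → F k = F (k + 1)) ∨
      (∀ k : ZMod (2 * m), ¬ Even k.val → F k = F (k + 1))) :
    ∑ k : ZMod (2 * m), (if Even k.val then F k else - F k) = 0 := by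
  have key : ∑ k : ZMod (2 * m), (if Even k.val then F k else 0)
      = ∑ k : ZMod (2 * m), (if Even k.val then 0 else F k) := by
    rcases hF with hF | hF
    · rw [← Equiv.sum_comp (Equiv.addRight (1 : ZMod (2 * m))) (fun k => if Even k.val then 0 else F k)]
      refine Finset.sum_congr rfl fun k _ => ?_
      have h1 := rc_even_succ m hm k
      have h2 := hF k
      simp only [Equiv.coe_addRight]
      by_cases h : Even k.val <;> grind
    · rw [← Equiv.sum_comp (Equiv.addRight (1 : ZMod (2 * m))) (fun k => if Even k.val then F k else 0)]
      refine Finset.sum_congr rfl fun k _ => ?_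
      have h1 := rc_even_succ m hm k
      have h2 := hF k
      simp only [Equiv.coe_addRight]
      by_cases h : Even k.val <;> grind
  rw [← sub_eq_zero, ← Finset.sum_sub_distrib] at key
  rw [← key]
  refine Finset.sum_congr rfl fun k _ => ?_
  split_ifs <;> simp

theorem rc_forward (S : Finset (ℕ × ℕ)) (m : ℕ) (c : ZMod (2 * m) → ℕ × ℕ)
    (h : IsRookCircuit S m c) :
    ∃ μ : ℕ × ℕ → ℝ, (∃ s ∈ S, μ s ≠ 0) ∧
        (∀ i, ∑ s ∈ S.filter (fun s => s.1 = i), μ s = 0) ∧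
        (∀ j, ∑ s ∈ S.filter (fun s => s.2 = j), μ s = 0) := by
  obtain ⟨hm, hinj, hmem, hc⟩ := h
  have : NeZero (2 * m) := ⟨by omega⟩
  refine ⟨fun s => ∑ k : ZMod (2 * m), if Even k.val then (if c k = s then 1 else 0)
    else - (if c k = s then 1 else 0), ⟨c 0, hmem 0, ?_⟩, ?_, ?_⟩
  · beta_reduce
    rw [Finset.sum_eq_single 0]
    · simp
    · intro b _ hb
      have : c b ≠ c 0 := fun h => hb (hinj h)
      simp [this]
    · simp
  · intro i
    rw [Finset.sum_comm]
    refine Eq.trans ?_ (rc_alt m hm (fun k => if (c k).1 = i then 1 else 0)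
      (Or.inl fun k hk => by simp only [((hc k).1 hk).1]))
    refine Finset.sum_congr rfl fun k _ => ?_
    have := hmem k
    by_cases hk : Even k.val
    · simp only [hk, if_true, Finset.sum_ite_eq, Finset.mem_filter, this, true_and]
    · simp only [hk, if_false, Finset.sum_neg_distrib, Finset.sum_ite_eq, Finset.mem_filter, this,
        true_and]
  · intro i
    rw [Finset.sum_comm]
    refine Eq.trans ?_ (rc_alt m hm (fun k => if (c k).2 = i then 1 else 0)
      (Or.inr fun k hk => by simp only [((hc k).2 hk).1]))
    refine Finset.sum_congr rfl fun k _ => ?_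
    have := hmem k
    by_cases hk : Even k.val
    · simp only [hk, if_true, Finset.sum_ite_eq, Finset.mem_filter, this, true_and]
    · simp only [hk, if_false, Finset.sum_neg_distrib, Finset.sum_ite_eq, Finset.mem_filter, this,
        true_and]

theorem rc_of_seq (S : Finset (ℕ × ℕ)) (x : ℕ → ℕ × ℕ) (hx : ∀ k, x k ∈ S)
    (he : ∀ k, Even k → (x k).1 = (x (k + 1)).1 ∧ (x k).2 ≠ (x (k + 1)).2)
    (ho : ∀ k, ¬ Even k → (x k).2 = (x (k + 1)).2 ∧ (x k).1 ≠ (x (k + 1)).1) :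
    ∃ m c, IsRookCircuit S m c := by
  classical
  obtain ⟨L, hL⟩ : ∃ L : ℕ → ℕ, L = fun k => if Even k then (x k).1 else (x k).2 := ⟨_, rfl⟩
  have hLe : ∀ k, Even k → L k = (x k).1 := fun k hk => by simp [hL, hk]
  have hLo : ∀ k, ¬ Even k → L k = (x k).2 := fun k hk => by simp only [hL, hk, if_false]
  have hex : ∃ m, 0 < m ∧ ∃ i, L i = L (i + 2 * m) := by
    have hf : ∀ n ∈ (Set.univ : Set ℕ), L (2 * n) ∈ ((S.image Prod.fst : Finset ℕ) : Set ℕ) := by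
      intro n _
      rw [hLe _ (by simp)]
      simp only [Finset.mem_coe]
      exact Finset.mem_image_of_mem _ (hx _)
    obtain ⟨a, _, b, _, hab, heq⟩ := Set.infinite_univ.exists_lt_map_eq_of_mapsTo hf
      (Finset.finite_toSet _)
    exact ⟨b - a, by omega, 2 * a, by rw [show 2 * a + 2 * (b - a) = 2 * b by omega]; exact heq⟩
  obtain ⟨hpos, i, hi⟩ := Nat.find_spec hex
  have hmin : ∀ d, 0 < d → d < Nat.find hex → ∀ i, L i ≠ L (i + 2 * d) :=
    fun d h1 h2 i h3 => Nat.find_min hex h2 ⟨h1, i, h3⟩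
  generalize Nat.find hex = m at *
  have hm : 2 ≤ m := by
    by_contra hlt
    obtain rfl : m = 1 := by omega
    by_cases h : Even i
    · have h1 := he i h
      have h2 := ho (i + 1) (by grind)
      rw [hLe i h, hLe _ (by grind)] at hi
      exact h2.2 (h1.1.symm.trans hi)
    · have h1 := ho i h
      have h2 := he (i + 1) (by grind)
      rw [hLo i h, hLo _ (by grind)] at hi
      exact h2.2 (h1.1.symm.trans hi)
  have hne : ∀ a b, a < b → b < a + 2 * m → x a ≠ x b := by
    intro a b hab hb hxe
    by_cases hp : Even (b - a)
    · obtain ⟨d, hd⟩ := hp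
      apply hmin d (by omega) (by omega) a
      have : a + 2 * d = b := by omega
      rw [this]
      by_cases h : Even a
      · rw [hLe a h, hLe b (by grind), hxe]
      · rw [hLo a h, hLo b (by grind), hxe]
    · by_cases h1 : b = a + 1
      · subst h1
        by_cases h : Even a
        · exact (he a h).2 (by rw [hxe])
        · exact (ho a h).2 (by rw [hxe])
      · have hq : ∃ d, b = a + 2 * d + 1 := ⟨(b - a) / 2, by grind⟩
        obtain ⟨d, rfl⟩ := hq
        apply hmin d (by omega) (by omega) a
        by_cases h : Even a
        · rw [hLe a h, hLe (a + 2 * d) (by grind), hxe, (he (a + 2 * d) (by grind)).1]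
        · rw [hLo a h, hLo (a + 2 * d) (by grind), hxe, (ho (a + 2 * d) (by grind)).1]
  have : NeZero (2 * m) := ⟨by omega⟩
  -- the weak circuit
  obtain ⟨c, hc⟩ : ∃ c : ZMod (2 * m) → ℕ × ℕ, c = fun k => x (i + 1 + k.val) := ⟨_, rfl⟩
  have hinj : Function.Injective c := by
    intro a b hab
    have h1 := ZMod.val_lt a
    have h2 := ZMod.val_lt b
    apply ZMod.val_injective
    simp only [hc] at hab
    by_contra hne'
    rcases Nat.lt_or_gt_of_ne hne' with h | h
    · exact hne _ _ (by omega) (by omega) hab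
    · exact hne _ _ (by omega) (by omega) hab.symm
  have hmem : ∀ k, c k ∈ S := fun k => by rw [hc]; exact hx _
  have hstep : ∀ k : ZMod (2 * m),
      (Even (i + 1 + k.val) → (c k).1 = (c (k + 1)).1 ∧ (c k).2 ≠ (c (k + 1)).2) ∧
      (¬ Even (i + 1 + k.val) → (c k).2 = (c (k + 1)).2 ∧ (c k).1 ≠ (c (k + 1)).1) := by
    intro k
    obtain ⟨hk, ⟨h1, h2⟩ | ⟨h1, h2⟩⟩ := rc_val_succ m hm k
    · simp only [hc, h2]
      exact ⟨he _, ho _⟩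
    · have hnn : x (i + 1) ≠ x (i + 2 * m) := hne _ _ (by omega) (by omega)
      have hidx : i + 1 + k.val = i + 2 * m := by omega
      simp only [hc, h2, hidx, add_zero]
      constructor
      · intro h
        have h' : Even i := by grind
        rw [hLe _ h, hLe _ h', (he i h').1] at hi
        exact ⟨hi.symm, fun h3 => hnn (Prod.ext hi h3.symm)⟩
      · intro h
        have h' : ¬ Even i := by grind
        rw [hLo _ h, hLo _ h', (ho i h').1] at hi
        exact ⟨hi.symm, fun h3 => hnn (Prod.ext h3.symm hi)⟩
  by_cases hpar : Even (i + 1)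
  · refine ⟨m, c, hm, hinj, hmem, fun k => ?_⟩
    have := hstep k
    rw [Nat.even_add] at this
    simpa [hpar] using this
  · refine ⟨m, fun k => c (k + 1), hm, hinj.comp (add_left_injective 1), fun k => hmem _,
      fun k => ?_⟩
    have := hstep (k + 1)
    rw [Nat.even_add, rc_even_succ m hm] at this
    simpa only [hpar, false_iff, not_not] using this

theorem rc_other (A : Finset (ℕ × ℕ)) (μ : ℕ × ℕ → ℝ) (h : ∑ s ∈ A, μ s = 0)
    (s : ℕ × ℕ) (hs : s ∈ A) (h0 : μ s ≠ 0) : ∃ t ∈ A, μ t ≠ 0 ∧ t ≠ s := by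
  by_contra hcon
  push Not at hcon
  rw [Finset.sum_eq_single s] at h
  · exact h0 h
  · intro b hb hbs
    by_contra hb0
    exact hbs (hcon b hb hb0)
  · exact fun h => absurd hs h

theorem rc_backward (S : Finset (ℕ × ℕ)) (μ : ℕ × ℕ → ℝ) (h : ∃ s ∈ S, μ s ≠ 0)
    (h1 : ∀ t ∈ S, ∑ s ∈ S.filter (fun s => s.1 = t.1), μ s = 0)
    (h2 : ∀ t ∈ S, ∑ s ∈ S.filter (fun s => s.2 = t.2), μ s = 0) :
    ∃ m c, IsRookCircuit S m c := by
  obtain ⟨s0, hs0, hμ0⟩ := h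
  have hr : ∀ t : {t // t ∈ S ∧ μ t ≠ 0}, ∃ u : {t // t ∈ S ∧ μ t ≠ 0},
      t.1.1 = u.1.1 ∧ t.1.2 ≠ u.1.2 := by
    rintro ⟨t, ht, ht0⟩
    obtain ⟨u, hu, hu0, hne⟩ := rc_other _ μ (h1 t ht) t (by simp [ht]) ht0
    rw [Finset.mem_filter] at hu
    exact ⟨⟨u, hu.1, hu0⟩, hu.2.symm, fun h => hne (Prod.ext hu.2 h.symm)⟩
  have hl : ∀ t : {t // t ∈ S ∧ μ t ≠ 0}, ∃ u : {t // t ∈ S ∧ μ t ≠ 0},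
      t.1.2 = u.1.2 ∧ t.1.1 ≠ u.1.1 := by
    rintro ⟨t, ht, ht0⟩
    obtain ⟨u, hu, hu0, hne⟩ := rc_other _ μ (h2 t ht) t (by simp [ht]) ht0
    rw [Finset.mem_filter] at hu
    exact ⟨⟨u, hu.1, hu0⟩, hu.2.symm, fun h => hne (Prod.ext h.symm hu.2)⟩
  choose r hr using hr
  choose l hl using hl
  let x : ℕ → {t // t ∈ S ∧ μ t ≠ 0} := fun n =>
    Nat.rec ⟨s0, hs0, hμ0⟩ (fun k t => if Even k then r t else l t) n
  have hxs : ∀ k, x (k + 1) = if Even k then r (x k) else l (x k) := fun k => rfl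
  refine rc_of_seq S (fun k => (x k).1) (fun k => (x k).2.1) ?_ ?_
  · intro k hk
    simp only [hxs, hk, if_true]
    exact hr _
  · intro k hk
    simp only [hxs, hk, if_false]
    exact hl _

/-- `S ⊆ {1,…,p} × {1,…,q}` contains a rook circuit iff there is a not-identically-zero
function `μ` supported on `S` all of whose row sums and column sums vanish. -/
theorem hasRookCircuit_iff_exists_vanishing_marginals (p q : ℕ) (S : Finset (ℕ × ℕ))
    (hS : S ⊆ Finset.Icc 1 p ×ˢ Finset.Icc 1 q) :
    (∃ m c, IsRookCircuit S m c) ↔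
      ∃ μ : ℕ × ℕ → ℝ, (∃ s ∈ S, μ s ≠ 0) ∧
        (∀ i ∈ Finset.Icc 1 p, ∑ s ∈ S.filter (fun s => s.1 = i), μ s = 0) ∧
        (∀ j ∈ Finset.Icc 1 q, ∑ s ∈ S.filter (fun s => s.2 = j), μ s = 0) := by
  constructor
  · rintro ⟨m, c, h⟩
    obtain ⟨μ, h0, h1, h2⟩ := rc_forward S m c h
    exact ⟨μ, h0, fun i _ => h1 i, fun j _ => h2 j⟩
  · rintro ⟨μ, h0, h1, h2⟩
    refine rc_backward S μ h0 (fun t ht => h1 _ ?_) (fun t ht => h2 _ ?_)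
    · exact (Finset.mem_product.1 (hS ht)).1
    · exact (Finset.mem_product.1 (hS ht)).2
end

section
/- Let R = {1,…,p} × {1,…,q} be the p × q integer grid and S ⊆ R. The following are equivalent: (i) every function f : S → ℝ is of additive form, i.e., there exist real numbers x₁,…,x_p and y₁,…,y_q such that f(i,j) = x_i + y_j for all (i,j) ∈ S; (ii) the only function μ : S → ℝ whose row sums and column sums all vanish (for every i, the sum of μ over points of S with first coordinate i is 0, and for every j, the sum of μ over points of S with second coordinate j is 0) is the zero function. -/
/-- For `S ⊆ {1,…,p} × {1,…,q}` the following are equivalent: (i) every real function on `S`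
is of additive form `f (i,j) = x i + y j`; (ii) the only function on `S` with all row sums
and column sums vanishing is the zero function. -/
theorem additive_iff_no_vanishing_marginals (p q : ℕ) (S : Finset (ℕ × ℕ))
    (hS : S ⊆ Finset.Icc 1 p ×ˢ Finset.Icc 1 q) :
    (∀ f : ℕ × ℕ → ℝ, ∃ x y : ℕ → ℝ, ∀ s ∈ S, f s = x s.1 + y s.2) ↔
      (∀ μ : ℕ × ℕ → ℝ,
        (∀ i ∈ Finset.Icc 1 p, ∑ s ∈ S.filter (fun s => s.1 = i), μ s = 0) →
        (∀ j ∈ Finset.Icc 1 q, ∑ s ∈ S.filter (fun s => s.2 = j), μ s = 0) →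
        ∀ s ∈ S, μ s = 0) := by
  classical
  constructor
  · intro h μ hr hc
    obtain ⟨x, y, hxy⟩ := h μ
    have h1 : ∑ s ∈ S, x s.1 * μ s = 0 := by
      rw [← Finset.sum_fiberwise_of_maps_to (s := S) (t := Finset.Icc 1 p) (g := Prod.fst)
        (fun s hs => (Finset.mem_product.1 (hS hs)).1)]
      refine Finset.sum_eq_zero fun i hi => ?_
      rw [← mul_zero (x i), ← hr i hi, Finset.mul_sum]
      refine Finset.sum_congr rfl fun s hs => ?_
      rw [(Finset.mem_filter.1 hs).2]
    have h2 : ∑ s ∈ S, y s.2 * μ s = 0 := by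
      rw [← Finset.sum_fiberwise_of_maps_to (s := S) (t := Finset.Icc 1 q) (g := Prod.snd)
        (fun s hs => (Finset.mem_product.1 (hS hs)).2)]
      refine Finset.sum_eq_zero fun i hi => ?_
      rw [← mul_zero (y i), ← hc i hi, Finset.mul_sum]
      refine Finset.sum_congr rfl fun s hs => ?_
      rw [(Finset.mem_filter.1 hs).2]
    have h3 : ∑ s ∈ S, μ s * μ s = 0 := by
      rw [← add_zero (0 : ℝ)]
      nth_rewrite 1 [← h1]
      rw [← h2, ← Finset.sum_add_distrib]
      refine Finset.sum_congr rfl fun s hs => ?_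
      rw [← add_mul, ← hxy s hs]
    intro s hs
    exact mul_self_eq_zero.1
      ((Finset.sum_eq_zero_iff_of_nonneg (fun s _ => mul_self_nonneg (μ s))).1 h3 s hs)
  · intro h
    let T : ((ℕ → ℝ) × (ℕ → ℝ)) →ₗ[ℝ] (S → ℝ) :=
      { toFun := fun z s => z.1 s.1.1 + z.2 s.1.2
        map_add' := by intro a b; ext s; simp; ring
        map_smul' := by intro a b; ext s; simp; ring }
    have hT : LinearMap.range T = ⊤ := by
      by_contra hne
      obtain ⟨φ, hφ, hle⟩ := Submodule.exists_le_ker_of_lt_top _ (lt_top_iff_ne_top.2 hne)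
      have hz : ∀ z, φ (T z) = 0 := fun z => hle ⟨z, rfl⟩
      let μ : ℕ × ℕ → ℝ := fun s => if h : s ∈ S then φ (Pi.single ⟨s, h⟩ 1) else 0
      have hμ : ∀ s : S, μ s = φ (Pi.single s 1) := fun s => by simp [μ]
      have key : ∀ g : S → ℝ, φ g = ∑ s : S, g s * μ s := by
        intro g
        conv_lhs => rw [pi_eq_sum_univ' g]
        rw [map_sum]
        refine Finset.sum_congr rfl fun s _ => ?_
        rw [map_smul, hμ, smul_eq_mul]
      have h0 := h μ (by
        intro i _
        have := hz (Pi.single i 1, 0)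
        rw [key] at this
        rw [Finset.sum_filter, ← Finset.sum_coe_sort S]
        refine Eq.trans ?_ this
        refine Finset.sum_congr rfl fun s _ => ?_
        simp [T, Pi.single_apply]) (by
        intro i _
        have := hz (0, Pi.single i 1)
        rw [key] at this
        rw [Finset.sum_filter, ← Finset.sum_coe_sort S]
        refine Eq.trans ?_ this
        refine Finset.sum_congr rfl fun s _ => ?_
        simp [T, Pi.single_apply])
      apply hφ
      ext1 s
      ext
      simp [key, h0]
    intro f
    obtain ⟨z, hzf⟩ := LinearMap.range_eq_top.1 hT (fun s => f s)
    exact ⟨z.1, z.2, fun s hs => (congrFun hzf ⟨s, hs⟩).symm⟩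
end

section
/- Let r ≥ 1 and k₁,…,k_r ≥ 1, and let S be a subset of the discrete hyper-rectangle ∏_{i=1}^r {1,…,k_i} with the property that every function f : S → ℝ is of additive form, i.e., there exist real numbers x_{i,v} (1 ≤ i ≤ r, 1 ≤ v ≤ k_i) with f(j₁,…,j_r) = x_{1,j₁} + ⋯ + x_{r,j_r} for all (j₁,…,j_r) ∈ S (S is a WDSA). Let W and Y be finite-dimensional complex inner product spaces and let M : W → Y be a linear map whose rank equals the cardinality of S. Then there exist linear maps O_i : ℂ^{k_i} → ℂ^{k_i} (1 ≤ i ≤ r) and linear isometries u : (ker M)^⊥ → ℂ^{k₁} ⊗ ⋯ ⊗ ℂ^{k_r} and v : range M → ℂ^{k₁} ⊗ ⋯ ⊗ ℂ^{k_r} such that (O₁ ⊗ ⋯ ⊗ O_r)(u(w)) = v(M w) for every w ∈ (ker M)^⊥. -/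
open Matrix

/-- The Kronecker (tensor) product of a family of square matrices, indexed by product types;
this realizes `O₁ ⊗ ⋯ ⊗ O_r` on `ℂ^{k₁} ⊗ ⋯ ⊗ ℂ^{k_r} ≅ ℂ^{k₁⋯k_r}`. -/
def kronFamily {r : ℕ} {k : Fin r → ℕ} (O : ∀ i, Matrix (Fin (k i)) (Fin (k i)) ℂ) :
    Matrix (∀ i, Fin (k i)) (∀ i, Fin (k i)) ℂ :=
  fun a b => ∏ i, O i (a i) (b i)

theorem exists_svd_aux {V R : Type*} [NormedAddCommGroup V] [InnerProductSpace ℂ V]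
    [FiniteDimensional ℂ V] [NormedAddCommGroup R] [InnerProductSpace ℂ R]
    [FiniteDimensional ℂ R] (T : V →ₗ[ℂ] R) (hT : Function.Injective T) {n : ℕ}
    (hV : Module.finrank ℂ V = n) (hR : Module.finrank ℂ R = n) :
    ∃ (e : OrthonormalBasis (Fin n) ℂ V) (f : OrthonormalBasis (Fin n) ℂ R) (σ : Fin n → ℝ),
      (∀ i, 0 < σ i) ∧ ∀ i, T (e i) = (σ i : ℂ) • f i := by
  have hsym : (T.adjoint ∘ₗ T).IsSymmetric := fun x y => by
    simp [LinearMap.adjoint_inner_left, LinearMap.adjoint_inner_right]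
  let e := hsym.eigenvectorBasis hV
  have hinner : ∀ i j, inner ℂ (T (e i)) (T (e j)) =
      (hsym.eigenvalues hV j : ℂ) * inner ℂ (e i) (e j) := by
    intro i j
    rw [← LinearMap.adjoint_inner_right]
    have := hsym.apply_eigenvectorBasis hV j
    rw [LinearMap.comp_apply] at this
    change inner ℂ (e i) ((LinearMap.adjoint T) (T (hsym.eigenvectorBasis hV j))) = _
    rw [this, inner_smul_right]
    rfl
  have hne : ∀ i, T (e i) ≠ 0 := fun i h => by
    have h0 : e i = 0 := hT (by rw [h, map_zero])
    exact e.orthonormal.ne_zero i h0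
  have ho : Orthonormal ℂ (fun i => ((‖T (e i)‖ : ℂ)⁻¹) • T (e i)) := by
    constructor
    · intro i
      have := norm_ne_zero_iff.2 (hne i)
      simp [norm_smul, this]
    · intro i j hij
      simp only [inner_smul_left, inner_smul_right, hinner, e.orthonormal.2 hij, mul_zero]
  have hsp : Module.finrank ℂ R = Fintype.card (Fin n) := by simp [hR]
  let b := basisOfLinearIndependentOfCardEqFinrank' _ ho.linearIndependent hsp.symm
  have hb : ⇑b = fun i => ((‖T (e i)‖ : ℂ)⁻¹) • T (e i) :=
    coe_basisOfLinearIndependentOfCardEqFinrank' _ _ _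
  refine ⟨e, b.toOrthonormalBasis (by rw [hb]; exact ho), fun i => ‖T (e i)‖,
    fun i => norm_pos_iff.2 (hne i), fun i => ?_⟩
  have := norm_ne_zero_iff.2 (hne i)
  rw [Module.Basis.coe_toOrthonormalBasis, hb, smul_smul, mul_inv_cancel₀, one_smul]
  exact_mod_cast this

theorem exists_isometry_aux {ι V E : Type*} [Fintype ι] [NormedAddCommGroup V]
    [InnerProductSpace ℂ V] [NormedAddCommGroup E] [InnerProductSpace ℂ E]
    (b : OrthonormalBasis ι ℂ V) (c : ι → E) (hc : Orthonormal ℂ c) :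
    ∃ u : V →ₗᵢ[ℂ] E, ∀ i, u (b i) = c i := by
  have h : ∀ i, (b.toBasis.constr ℂ c) (b i) = c i := fun i => by
    rw [← b.coe_toBasis, Module.Basis.constr_basis]
  refine ⟨LinearMap.isometryOfOrthonormal (v := b.toBasis) (b.toBasis.constr ℂ c)
    (by simpa using b.orthonormal) ?_, fun i => h i⟩
  have : (b.toBasis.constr ℂ c) ∘ b.toBasis = c := by
    funext i; exact Module.Basis.constr_basis _ _ _ _
  rw [this]; exact hc

/-- If `S` is a WDSA in the hyper-rectangle `∏ᵢ {1,…,kᵢ}` (every real function on `S` is of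
additive form), and `M : W → Y` is a linear map of rank `|S|` between finite-dimensional
complex inner product spaces, then `M` embeds isometrically into a tensor-product operator
`O₁ ⊗ ⋯ ⊗ O_r` on `ℂ^{k₁} ⊗ ⋯ ⊗ ℂ^{k_r}`: there are linear isometries
`u : (ker M)ᗮ → ℂ^{k₁} ⊗ ⋯ ⊗ ℂ^{k_r}` and `v : range M → ℂ^{k₁} ⊗ ⋯ ⊗ ℂ^{k_r}` with
`(O₁ ⊗ ⋯ ⊗ O_r)(u w) = v (M w)` for all `w ∈ (ker M)ᗮ`. -/
theorem wdsa_partial_tensor_decomposition {r : ℕ} (hr : 1 ≤ r)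
    (k : Fin r → ℕ) (hk : ∀ i, 1 ≤ k i)
    (S : Finset (∀ i : Fin r, Fin (k i)))
    (hS : ∀ f : (∀ i, Fin (k i)) → ℝ, ∃ x : ∀ i : Fin r, Fin (k i) → ℝ,
      ∀ j ∈ S, f j = ∑ i, x i (j i))
    {W Y : Type*} [NormedAddCommGroup W] [InnerProductSpace ℂ W] [FiniteDimensional ℂ W]
    [NormedAddCommGroup Y] [InnerProductSpace ℂ Y] [FiniteDimensional ℂ Y]
    (M : W →ₗ[ℂ] Y) (hrank : Module.finrank ℂ (LinearMap.range M) = S.card) :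
    ∃ O : ∀ i, Matrix (Fin (k i)) (Fin (k i)) ℂ,
    ∃ u : (LinearMap.ker M)ᗮ →ₗᵢ[ℂ] EuclideanSpace ℂ (∀ i, Fin (k i)),
    ∃ v : (LinearMap.range M) →ₗᵢ[ℂ] EuclideanSpace ℂ (∀ i, Fin (k i)),
      ∀ w : (LinearMap.ker M)ᗮ,
        (kronFamily O).mulVec (u w) = v ⟨M w.1, LinearMap.mem_range_self M w.1⟩ := by
  classical
  let V := (LinearMap.ker M)ᗮ
  let T : V →ₗ[ℂ] LinearMap.range M := M.rangeRestrict ∘ₗ V.subtype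
  have hTinj : Function.Injective T := by
    rw [← LinearMap.ker_eq_bot, LinearMap.ker_eq_bot']
    intro m hm
    have h1 : (m : W) ∈ LinearMap.ker M := by
      have := congrArg Subtype.val hm
      simpa [T] using this
    have h2 : inner ℂ (m : W) (m : W) = 0 := m.2 _ h1
    exact Subtype.ext (inner_self_eq_zero.1 h2)
  have hV : Module.finrank ℂ V = S.card := by
    have h1 := LinearMap.finrank_range_add_finrank_ker M
    have h2 := Submodule.finrank_add_finrank_orthogonal (LinearMap.ker M)
    change Module.finrank ℂ (LinearMap.ker M)ᗮ = _
    omega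
  obtain ⟨e, f, σ, hσ, hT⟩ := exists_svd_aux T hTinj hV hrank
  let g : Fin S.card ≃ S := S.equivFin.symm
  obtain ⟨x, hx⟩ := hS (fun j => if h : j ∈ S then Real.log (σ (g.symm ⟨j, h⟩)) else 0)
  let c : Fin S.card → EuclideanSpace ℂ (∀ i, Fin (k i)) :=
    fun a => EuclideanSpace.single (g a).1 1
  have hc : Orthonormal ℂ c := 
    (EuclideanSpace.orthonormal_single (𝕜 := ℂ) (ι := ∀ i, Fin (k i))).comp
      (fun a => (g a).1) (Subtype.val_injective.comp g.injective)
  obtain ⟨u, hu⟩ := exists_isometry_aux e c hc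
  obtain ⟨v, hv⟩ := exists_isometry_aux f c hc
  let O : ∀ i, Matrix (Fin (k i)) (Fin (k i)) ℂ :=
    fun i => Matrix.diagonal (fun a => ((Real.exp (x i a) : ℝ) : ℂ))
  refine ⟨O, u, v, ?_⟩
  have hO : ∀ a, (kronFamily O).mulVec (c a) = (σ a : ℂ) • (c a : (∀ i, Fin (k i)) → ℂ) := by
    intro a
    have hxa := hx (g a).1 (g a).2
    have hs : ∏ i, Real.exp (x i ((g a).1 i)) = σ a := by
      rw [← Real.exp_sum, ← hxa]
      simp [Real.exp_log (hσ a)]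
    funext b
    simp only [c, EuclideanSpace.ofLp_single, Matrix.mulVec_single_one, Matrix.col_apply,
      Pi.smul_apply, smul_eq_mul, kronFamily, O]
    by_cases hb : b = (g a).1
    · subst hb
      simp only [Matrix.diagonal_apply_eq, Pi.single_eq_same, mul_one]
      exact_mod_cast hs
    · rw [Pi.single_eq_of_ne hb, mul_zero]
      obtain ⟨i, hi⟩ := Function.ne_iff.1 hb
      exact Finset.prod_eq_zero (Finset.mem_univ i) (Matrix.diagonal_apply_ne _ hi)
  let L := (WithLp.linearEquiv 2 ℂ ((∀ i, Fin (k i)) → ℂ)).toLinearMap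
  have key : (kronFamily O).mulVecLin ∘ₗ L ∘ₗ u.toLinearMap = L ∘ₗ v.toLinearMap ∘ₗ T := by
    refine e.toBasis.ext fun a => ?_
    rw [e.coe_toBasis]
    change (kronFamily O).mulVec (u (e a)).ofLp = (v (T (e a))).ofLp
    rw [hT, hu, map_smul, hv, hO]
    rfl
  intro w
  exact LinearMap.congr_fun key w
end

section
/- (Kolmogorov–Arnold representation theorem.) Let n ≥ 2. There exist n(2n+1) continuous functions φ_{p,q} : [0,1] → [0,1] (1 ≤ p ≤ n, 1 ≤ q ≤ 2n+1) such that for every continuous function f : [0,1]^n → ℝ there exist continuous functions α_q : ℝ → ℝ (1 ≤ q ≤ 2n+1) with f(x₁,…,x_n) = Σ_{q=1}^{2n+1} α_q( Σ_{p=1}^{n} φ_{p,q}(x_p) ) for all (x₁,…,x_n) ∈ [0,1]^n. -/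
namespace KA
open unitInterval

theorem surj_of_approx {E F : Type*} [NormedAddCommGroup E] [NormedSpace ℝ E] [CompleteSpace E]
    [NormedAddCommGroup F] [NormedSpace ℝ F] (T : E →L[ℝ] F) (C r : ℝ) (hr0 : 0 ≤ r) (hr : r < 1)
    (h : ∀ y, ∃ x, ‖x‖ ≤ C * ‖y‖ ∧ ‖y - T x‖ ≤ r * ‖y‖) (y : F) : ∃ x, T x = y := by
  choose g hg1 hg2 using h
  let R : F → F := fun y => y - T (g y)
  have hR : ∀ k, ‖R^[k] y‖ ≤ r ^ k * ‖y‖ := by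
    intro k
    induction k with
    | zero => simp
    | succ k ih =>
      rw [Function.iterate_succ_apply']
      calc _ ≤ r * ‖R^[k] y‖ := hg2 _
        _ ≤ r * (r ^ k * ‖y‖) := by gcongr
        _ = _ := by ring
  let u : ℕ → E := fun k => g (R^[k] y)
  have hu : Summable u := by
    refine Summable.of_norm_bounded (g := fun k => |C| * ‖y‖ * r ^ k)
      ((summable_geometric_of_lt_one hr0 hr).mul_left _) ?_
    intro k
    calc ‖u k‖ ≤ C * ‖R^[k] y‖ := hg1 _
      _ ≤ |C| * (r ^ k * ‖y‖) := by
        gcongr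
        · exact le_abs_self C
        · exact hR k
      _ = _ := by ring
  have hsum : ∀ k, T (∑ i ∈ Finset.range k, u i) = y - R^[k] y := by
    intro k
    induction k with
    | zero => simp
    | succ k ih =>
      rw [Finset.sum_range_succ, map_add, ih, Function.iterate_succ_apply']
      simp only [u, R]; abel
  have h0 : Filter.Tendsto (fun k => R^[k] y) Filter.atTop (nhds 0) := by
    apply squeeze_zero_norm hR
    simpa using (tendsto_pow_atTop_nhds_zero_of_lt_one hr0 hr).mul_const ‖y‖
  refine ⟨∑' k, u k, ?_⟩
  have h1 := (T.continuous.tendsto _).comp hu.hasSum.tendsto_sum_nat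
  have h2 : Filter.Tendsto (fun k => y - R^[k] y) Filter.atTop (nhds (y - 0)) :=
    tendsto_const_nhds.sub h0
  rw [sub_zero] at h2
  refine tendsto_nhds_unique h1 (h2.congr fun k => (hsum k).symm)

/-- staircase -/
noncomputable def st (K : ℝ) (y : ℝ) : ℝ := y + (- Int.fract y - 1 + min 1 (K * Int.fract y))

theorem st_cont (K : ℝ) (hK : 1 ≤ K) : Continuous (st K) := by
  unfold st
  apply continuous_id.add
  refine ContinuousOn.comp_fract'' (f := fun u : ℝ => -u - 1 + min 1 (K * u)) ?_ ?_
  · fun_prop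
  · simp [hK]

theorem st_le (K y : ℝ) : st K y ≤ y := by
  have := Int.fract_nonneg y
  have := min_le_left 1 (K * Int.fract y)
  unfold st; linarith

theorem le_st (K y : ℝ) (hK : 1 ≤ K) : y - 1 ≤ st K y := by
  have h0 := Int.fract_nonneg y
  have h1 := Int.fract_lt_one y
  unfold st
  have : Int.fract y ≤ min 1 (K * Int.fract y) := le_min h1.le (by nlinarith)
  linarith

theorem st_good (K y : ℝ) (hK : 0 < K) (h : 1 / K ≤ Int.fract y) : st K y = ⌊y⌋ := by
  have : 1 ≤ K * Int.fract y := by rwa [div_le_iff₀' hK] at h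
  unfold st
  rw [min_eq_left this]
  have := Int.floor_add_fract y
  linarith

/-- badness is unique -/
theorem bad_unique (K : ℕ) (hK : 0 < K) (a : ℝ) (q q' : Fin K)
    (h : Int.fract (a + (q : ℕ) / (K : ℝ)) < 1 / K) (h' : Int.fract (a + (q' : ℕ) / (K : ℝ)) < 1 / K) :
    q = q' := by
  have hK' : (0 : ℝ) < K := by exact_mod_cast hK
  have e1 := Int.floor_add_fract (a + (q : ℕ) / (K : ℝ))
  have e2 := Int.floor_add_fract (a + (q' : ℕ) / (K : ℝ))
  have p1 := Int.fract_nonneg (a + (q : ℕ) / (K : ℝ))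
  have p2 := Int.fract_nonneg (a + (q' : ℕ) / (K : ℝ))
  set m := ⌊a + (q : ℕ) / (K : ℝ)⌋
  set m' := ⌊a + (q' : ℕ) / (K : ℝ)⌋
  set u := Int.fract (a + (q : ℕ) / (K : ℝ))
  set u' := Int.fract (a + (q' : ℕ) / (K : ℝ))
  rw [lt_div_iff₀ hK'] at h h'
  have e3 : ((q : ℕ) : ℝ) - (q' : ℕ) - K * (m - m') = u * K - u' * K := by
    have : ((q : ℕ) : ℝ) / K - (q' : ℕ) / K = (m - m') + (u - u') := by linarith
    field_simp at this
    linarith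
  have p1' : 0 ≤ u * K := by positivity
  have p2' : 0 ≤ u' * K := by positivity
  have l1 : (((q : ℕ) : ℤ) - (q' : ℕ) - K * (m - m') : ℤ) < 1 := by
    have : ((q : ℕ) : ℝ) - (q' : ℕ) - K * (m - m') < 1 := by linarith
    exact_mod_cast this
  have l2 : -1 < (((q : ℕ) : ℤ) - (q' : ℕ) - K * (m - m') : ℤ) := by
    have : -1 < ((q : ℕ) : ℝ) - (q' : ℕ) - K * (m - m') := by linarith
    exact_mod_cast this
  have hq := q.2
  have hq' := q'.2
  have hd : ((K : ℤ)) ∣ ((q : ℕ) : ℤ) - (q' : ℕ) := ⟨m - m', by omega⟩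
  have := Int.eq_zero_of_abs_lt_dvd hd (by rw [abs_lt]; omega)
  ext; omega

/-- generic perturbation -/
theorem generic (n N : ℕ) (c : Fin n → ℕ → ℝ) (d : ℝ) (hd : 0 < d) :
    ∃ e : ℝ, 0 < e ∧ e < d ∧ Function.Injective
      (fun J : Fin n → Fin (N + 1) => ∑ p, (c p (J p) + e * (((J p : ℕ) : ℝ) * (N + 1 : ℝ) ^ (p : ℕ)))) := by
  let A : (Fin n → Fin (N + 1)) → ℝ := fun J => ∑ p, c p (J p)
  let B : (Fin n → Fin (N + 1)) → ℝ := fun J => ∑ p, ((J p : ℕ) : ℝ) * (N + 1 : ℝ) ^ (p : ℕ)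
  have hB : Function.Injective B := by
    intro J J' h
    apply finFunctionFinEquiv.injective
    ext
    simp only [finFunctionFinEquiv_apply]
    simp only [B] at h
    exact_mod_cast h
  let bad : Set ℝ := Set.range fun P : (Fin n → Fin (N + 1)) × (Fin n → Fin (N + 1)) =>
    (A P.2 - A P.1) / (B P.1 - B P.2)
  have hbad : bad.Finite := Set.finite_range _
  obtain ⟨e, he, hne⟩ := ((Set.Ioo_infinite hd).sdiff hbad).nonempty
  refine ⟨e, he.1, he.2, ?_⟩
  intro J J' h
  by_contra hJ
  have hB' : B J - B J' ≠ 0 := fun h0 => hJ (hB (sub_eq_zero.1 h0))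
  apply hne
  refine ⟨(J, J'), ?_⟩
  simp only [Finset.sum_add_distrib, ← Finset.mul_sum] at h
  change A J + e * B J = A J' + e * B J' at h
  rw [div_eq_iff hB']
  linarith

noncomputable def S {n : ℕ} (φ : Fin n → C(I, ℝ)) : C(Fin n → I, ℝ) :=
  ⟨fun x => ∑ p, φ p (x p), by fun_prop⟩

theorem S_cont (n : ℕ) : Continuous (S : (Fin n → C(I, ℝ)) → C(Fin n → I, ℝ)) := by
  have : (S : (Fin n → C(I, ℝ)) → C(Fin n → I, ℝ)) =
      fun φ => ∑ p, (φ p).comp (⟨fun x => x p, by fun_prop⟩ : C(Fin n → I, I)) := by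
    ext φ x; simp [S]
  rw [this]
  refine continuous_finsetSum _ fun p _ => ?_
  exact (ContinuousMap.continuous_precomp _).comp (continuous_apply p)

noncomputable def T {n K : ℕ} (φ : Fin K → Fin n → C(I, ℝ)) :
    (Fin K → BoundedContinuousFunction ℝ ℝ) →L[ℝ] C(Fin n → I, ℝ) :=
  LinearMap.mkContinuous
    { toFun := fun α => ∑ q, (α q).toContinuousMap.comp (S (φ q))
      map_add' := by
        intro a b; ext x; simp [Finset.sum_add_distrib]
      map_smul' := by
        intro c a; ext x; simp [Finset.mul_sum] } K (by
    intro α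
    rw [ContinuousMap.norm_le _ (by positivity)]
    intro x
    simp only [LinearMap.coe_mk, AddHom.coe_mk, ContinuousMap.coe_sum, Finset.sum_apply]
    refine (norm_sum_le _ _).trans ?_
    refine (Finset.sum_le_card_nsmul _ _ ‖α‖ fun q _ => ?_).trans ?_
    · exact ((α q).norm_coe_le_norm _).trans (norm_le_pi_norm α q)
    · simp)

theorem T_apply {n K : ℕ} (φ : Fin K → Fin n → C(I, ℝ)) (α) (x : Fin n → I) :
    T φ α x = ∑ q, α q (∑ p, φ q p (x p)) := by
  simp [T, S]

theorem T_cont {n K : ℕ} (α : Fin K → BoundedContinuousFunction ℝ ℝ) :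
    Continuous (fun φ : Fin K → Fin n → C(I, ℝ) => T φ α) := by
  change Continuous (fun φ : Fin K → Fin n → C(I, ℝ) =>
    ∑ q, (α q).toContinuousMap.comp (S (φ q)))
  refine continuous_finsetSum _ fun q _ => ?_
  exact (ContinuousMap.continuous_postcomp _).comp ((S_cont n).comp (continuous_apply q))

theorem perq (n N K q : ℕ) (hN : 0 < N) (hq : q < K) (φ₀ : Fin n → C(I, ℝ)) (g : C(Fin n → I, ℝ))
    (δ η : ℝ) (hδ : 0 < δ)
    (hφ : ∀ p, ∀ u v : I, dist u v ≤ 1 / N → dist (φ₀ p u) (φ₀ p v) ≤ δ / 2)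
    (hg : ∀ u v : Fin n → I, dist u v ≤ 1 / N → dist (g u) (g v) ≤ η) :
    ∃ φ : Fin n → C(I, ℝ), (∀ p t, dist (φ p t) (φ₀ p t) ≤ δ) ∧
      ∃ α : BoundedContinuousFunction ℝ ℝ, ‖α‖ ≤ ‖g‖ ∧
      ∀ x : Fin n → I, (∀ p, 1 / (K : ℝ) ≤ Int.fract ((N : ℝ) * (x p : ℝ) + (q : ℝ) / (K : ℝ))) →
        dist (α (∑ p, φ p (x p))) (g x) ≤ η := by
  have hN' : (0 : ℝ) < N := by exact_mod_cast hN
  have hK0 : 0 < K := by omega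
  have hK' : (0 : ℝ) < K := by exact_mod_cast hK0
  have hK1 : (1 : ℝ) ≤ K := by exact_mod_cast hK0
  have hq0 : (0 : ℝ) ≤ q / K := by positivity
  have hq1 : (q : ℝ) / K < 1 := by rw [div_lt_one hK']; exact_mod_cast hq
  let pr : ℝ → I := Set.projIcc 0 1 zero_le_one
  have hpr : ∀ (z : ℝ) (t : I), |z - t| ≤ 1 / N → dist (pr z) t ≤ 1 / N := by
    intro z t h
    have h1 : pr (t : ℝ) = t := Set.projIcc_val _ t
    have h2 := (LipschitzWith.projIcc (zero_le_one (α := ℝ))).dist_le_mul z t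
    rw [← Real.dist_eq] at h
    calc dist (pr z) t = dist (pr z) (pr t) := by rw [h1]
      _ ≤ 1 * dist z t := h2
      _ ≤ _ := by simpa using h
  let y : I → ℝ := fun t => (N : ℝ) * (t : ℝ) + (q : ℝ) / (K : ℝ)
  have hy : Continuous y := by fun_prop
  have hst : ∀ t : I, |st K (y t) / N - t| ≤ 1 / N := by
    intro t
    have h1 := st_le K (y t)
    have h2 := le_st K (y t) hK1
    have : st K (y t) / N - t = (st K (y t) - N * t) / N := by field_simp
    rw [this, abs_div, abs_of_pos hN']
    gcongr
    rw [abs_le]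
    simp only [y] at h1 h2 ⊢
    constructor <;> linarith
  have hstb : ∀ t : I, |st K (y t)| ≤ N + 1 := by
    intro t
    have h1 := st_le K (y t)
    have h2 := le_st K (y t) hK1
    have h3 := t.2.1
    have h4 : (N : ℝ) * t ≤ N * 1 := by gcongr; exact t.2.2
    have h5 : (0 : ℝ) ≤ N * t := by positivity
    rw [abs_le]
    simp only [y] at h1 h2 ⊢
    constructor <;> linarith
  let D : ℝ := δ / 2 / ((N + 1) * (N + 1) ^ n)
  have hD : 0 < D := by positivity
  obtain ⟨e, he0, heD, hinj⟩ := generic n N (fun p j => φ₀ p (pr ((j : ℝ) / N))) D hD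
  let φ : Fin n → C(I, ℝ) := fun p =>
    ⟨fun t => φ₀ p (pr (st K (y t) / N)) + e * (st K (y t) * (N + 1 : ℝ) ^ (p : ℕ)), by
      have := (st_cont K hK1).comp hy
      have h2 : Continuous pr := continuous_projIcc
      simp only [Function.comp_def] at this
      fun_prop⟩
  refine ⟨φ, ?_, ?_⟩
  · intro p t
    have h1 := hφ p _ _ (hpr _ _ (hst t))
    have h2 : |e * (st K (y t) * (N + 1 : ℝ) ^ (p : ℕ))| ≤ δ / 2 := by
      rw [abs_mul, abs_mul, abs_of_pos he0, abs_of_pos (by positivity : (0:ℝ) < (N + 1 : ℝ) ^ (p : ℕ))]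
      calc _ ≤ D * ((N + 1) * (N + 1) ^ n) := by
            gcongr
            · exact hstb t
            · linarith
            · exact p.2.le
        _ = δ / 2 := by simp only [D]; field_simp
    rw [Real.dist_eq] at h1 ⊢
    have : φ p t - φ₀ p t = (φ₀ p (pr (st K (y t) / N)) - φ₀ p t) +
      e * (st K (y t) * (N + 1 : ℝ) ^ (p : ℕ)) := by simp only [φ, ContinuousMap.coe_mk]; ring
    rw [this]
    refine (abs_add_le _ _).trans ?_
    linarith
  · let v : BoundedContinuousFunction (Fin n → Fin (N + 1)) ℝ :=
      BoundedContinuousFunction.mkOfCompact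
        ⟨fun J => g (fun p => pr ((J p : ℕ) / N)), continuous_of_discreteTopology⟩
    have hemb := (continuous_of_discreteTopology (f := (fun J : Fin n → Fin (N + 1) =>
      ∑ p, (φ₀ p (pr (((J p : ℕ) : ℝ) / N)) + e * (((J p : ℕ) : ℝ) * (N + 1 : ℝ) ^ (p : ℕ)))))).isClosedEmbedding hinj
    obtain ⟨α, hα1, hα2⟩ := BoundedContinuousFunction.exists_extension_norm_eq_of_isClosedEmbedding v hemb
    refine ⟨α, ?_, ?_⟩
    · rw [hα1, BoundedContinuousFunction.norm_le (norm_nonneg _)]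
      intro J
      exact g.norm_coe_le_norm _
    · intro x hx
      have hfl : ∀ p, ∃ j : Fin (N + 1), st K (y (x p)) = ((j : ℕ) : ℝ) := by
        intro p
        have h1 := st_good K (y (x p)) hK' (hx p)
        have h3 := (x p).2.1
        have h4 : (N : ℝ) * (x p) ≤ N * 1 := by gcongr; exact (x p).2.2
        have h5 : (0 : ℝ) ≤ N * (x p) := by positivity
        have h6 : 0 ≤ ⌊y (x p)⌋ := Int.floor_nonneg.2 (by simp only [y]; linarith)
        have h7 : ⌊y (x p)⌋ < (N : ℤ) + 1 := Int.floor_lt.2 (by simp only [y]; push_cast; linarith)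
        refine ⟨⟨⌊y (x p)⌋.toNat, by omega⟩, ?_⟩
        rw [h1]
        have : (⌊y (x p)⌋.toNat : ℤ) = ⌊y (x p)⌋ := Int.toNat_of_nonneg h6
        exact_mod_cast this.symm
      choose J hJ using hfl
      have e1 : ∑ p, φ p (x p) = ∑ p, (φ₀ p (pr (((J p : ℕ) : ℝ) / N)) + e * (((J p : ℕ) : ℝ) * (N + 1 : ℝ) ^ (p : ℕ))) := by
        refine Finset.sum_congr rfl fun p _ => ?_
        simp only [φ, ContinuousMap.coe_mk, hJ]
      have e2 := congrFun hα2 J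
      simp only [Function.comp_apply] at e2
      rw [e1, e2]
      change dist (g (fun p => pr ((J p : ℕ) / N))) (g x) ≤ η
      apply hg
      rw [dist_pi_le_iff (by positivity)]
      intro p
      apply hpr
      rw [← hJ]
      exact hst _

theorem count (n N : ℕ) (x : Fin n → ℝ) :
    (Finset.univ.filter fun q : Fin (2 * n + 1) => ¬ ∀ p, 1 / ((2 * n + 1 : ℕ) : ℝ) ≤
      Int.fract ((N : ℝ) * x p + ((q : ℕ) : ℝ) / ((2 * n + 1 : ℕ) : ℝ))).card ≤ n := by
  have hsub : (Finset.univ.filter fun q : Fin (2 * n + 1) => ¬ ∀ p, 1 / ((2 * n + 1 : ℕ) : ℝ) ≤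
      Int.fract ((N : ℝ) * x p + ((q : ℕ) : ℝ) / ((2 * n + 1 : ℕ) : ℝ))) ⊆
      Finset.univ.biUnion fun p => Finset.univ.filter fun q : Fin (2 * n + 1) =>
        Int.fract ((N : ℝ) * x p + ((q : ℕ) : ℝ) / ((2 * n + 1 : ℕ) : ℝ)) < 1 / ((2 * n + 1 : ℕ) : ℝ) := by
    intro q hq
    simpa only [Finset.mem_filter, Finset.mem_univ, true_and, Finset.mem_biUnion, not_forall, not_le] using hq
  refine (Finset.card_le_card hsub).trans (Finset.card_biUnion_le.trans ?_)
  refine (Finset.sum_le_card_nsmul _ _ 1 fun p _ => ?_).trans (by simp)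
  rw [Finset.card_le_one]
  intro a ha b hb
  simp only [Finset.mem_filter, Finset.mem_univ, true_and] at ha hb
  exact bad_unique (2 * n + 1) (by omega) _ a b ha hb

theorem final_bound (n : ℕ) (a : Fin (2 * n + 1) → ℝ) (w W η : ℝ) (good : Fin (2 * n + 1) → Prop)
    [DecidablePred good] (hη : 0 ≤ η)
    (hc : (Finset.univ.filter fun q => ¬ good q).card ≤ n) (hw : |w| ≤ W) (ha : ∀ q, |a q| ≤ W)
    (hgood : ∀ q, good q → |a q - w| ≤ η) :
    |(n + 1) * w - ∑ q, a q| ≤ n * W + (2 * n + 1) * η := by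
  have hcard := Finset.card_filter_add_card_filter_not (s := (Finset.univ : Finset (Fin (2 * n + 1)))) good
  rw [Finset.card_univ, Fintype.card_fin] at hcard
  have hs := Finset.sum_filter_add_sum_filter_not (Finset.univ : Finset (Fin (2 * n + 1))) good a
  set G := Finset.univ.filter fun q => good q
  set B := Finset.univ.filter fun q => ¬ good q
  have h1 : |∑ q ∈ G, (a q - w)| ≤ G.card * η := by
    refine (Finset.abs_sum_le_sum_abs _ _).trans ?_
    rw [← nsmul_eq_mul]
    exact Finset.sum_le_card_nsmul _ _ _ fun q hq => hgood q (Finset.mem_filter.1 hq).2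
  have h2 : |∑ q ∈ B, a q| ≤ B.card * W := by
    refine (Finset.abs_sum_le_sum_abs _ _).trans ?_
    rw [← nsmul_eq_mul]
    exact Finset.sum_le_card_nsmul _ _ _ fun q hq => ha q
  rw [Finset.sum_sub_distrib, Finset.sum_const, nsmul_eq_mul] at h1
  have hcR : (G.card : ℝ) + B.card = 2 * n + 1 := by exact_mod_cast hcard
  have hcB : (B.card : ℝ) ≤ n := by exact_mod_cast hc
  have h3 : |((n : ℝ) - B.card) * w| ≤ (n - B.card) * W := by
    rw [abs_mul, abs_of_nonneg (by linarith)]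
    gcongr
  have h4 : (G.card : ℝ) * η ≤ (2 * n + 1) * η := by
    gcongr
    have : (0 : ℝ) ≤ B.card := by positivity
    linarith
  have hG : (G.card : ℝ) = 2 * n + 1 - B.card := by linarith
  rw [hG] at h1
  rw [← hs]
  have hG' : (G.card : ℝ) * η = (2 * n + 1 - B.card) * η := by rw [hG]
  rw [abs_le] at *
  constructor <;> nlinarith

theorem dense_step (n : ℕ) (f : C(Fin n → I, ℝ)) (hf : f ≠ 0) :
    Dense {φ : Fin (2 * n + 1) → Fin n → C(I, ℝ) | ∃ α, ‖α‖ ≤ ‖f‖ ∧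
      ‖f - T φ α‖ < (2 * n + 1) / (2 * n + 2) * ‖f‖} := by
  rw [Metric.dense_iff]
  intro φ₀ δ' hδ'
  have hF : 0 < ‖f‖ := norm_pos_iff.2 hf
  let δ := δ' / 2
  have hδ : 0 < δ := by positivity
  let g : C(Fin n → I, ℝ) := (1 / ((n : ℝ) + 1)) • f
  have hgn : ‖g‖ = ‖f‖ / (n + 1) := by
    simp only [g]
    rw [norm_smul, Real.norm_of_nonneg (by positivity)]; ring
  have hg : 0 < ‖g‖ := by rw [hgn]; positivity
  let η := ‖g‖ / (4 * (2 * n + 1))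
  have hη : 0 < η := by positivity
  have hug := Metric.uniformContinuous_iff_le.1
    (CompactSpace.uniformContinuous_of_continuous g.continuous) η hη
  have huφ := fun q p => Metric.uniformContinuous_iff_le.1
    (CompactSpace.uniformContinuous_of_continuous (φ₀ q p).continuous) (δ / 2) (half_pos hδ)
  obtain ⟨d, hd, hgd⟩ := hug
  choose dd hdd hφd using huφ
  have hev : ∀ᶠ N : ℕ in Filter.atTop, 0 < N ∧ (1 : ℝ) / N ≤ d ∧ ∀ q p, (1 : ℝ) / N ≤ dd q p := by
    have ht := tendsto_one_div_atTop_nhds_zero_nat (𝕜 := ℝ)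
    refine (Filter.eventually_gt_atTop 0).and ((ht.eventually_le_const hd).and ?_)
    rw [Filter.eventually_all]; intro q
    rw [Filter.eventually_all]; intro p
    exact ht.eventually_le_const (hdd q p)
  obtain ⟨N, hN, hNd, hNdd⟩ := hev.exists
  choose φ hφ α hα1 hα2 using fun q : Fin (2 * n + 1) => perq n N (2 * n + 1) q hN q.2 (φ₀ q) g δ η hδ
    (fun p u v h => hφd q p (h.trans (hNdd q p))) (fun u v h => hgd (h.trans hNd))
  refine ⟨φ, ?_, α, ?_, ?_⟩
  · rw [Metric.mem_ball]
    refine lt_of_le_of_lt ?_ (half_lt_self hδ')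
    rw [dist_pi_le_iff hδ.le]; intro q
    rw [dist_pi_le_iff hδ.le]; intro p
    rw [ContinuousMap.dist_le hδ.le]
    exact hφ q p
  · rw [pi_norm_le_iff_of_nonneg hF.le]
    intro q
    refine (hα1 q).trans ?_
    rw [hgn]
    exact div_le_self hF.le (by linarith [(Nat.cast_nonneg n : (0 : ℝ) ≤ n)])
  · have hb : ‖f - T φ α‖ ≤ n * ‖g‖ + (2 * n + 1) * η := by
      rw [ContinuousMap.norm_le _ (by positivity)]
      intro x
      classical
      have hfx : f x = (n + 1) * g x := by
        simp only [g, ContinuousMap.smul_apply, smul_eq_mul]; field_simp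
      rw [ContinuousMap.sub_apply, T_apply, Real.norm_eq_abs, hfx]
      refine final_bound n (fun q => α q (∑ p, φ q p (x p))) (g x) ‖g‖ η _ hη.le
        (count n N fun p => (x p : ℝ)) (g.norm_coe_le_norm x)
        (fun q => ((α q).norm_coe_le_norm _).trans (hα1 q)) ?_
      intro q hq
      exact hα2 q x hq
    refine hb.trans_lt ?_
    have e1 : (2 * n + 1) * η = ‖g‖ / 4 := by simp only [η]; field_simp
    have e2 : ‖f‖ = (n + 1) * ‖g‖ := by rw [hgn]; field_simp
    rw [e1, e2]
    have : ((2 : ℝ) * n + 1) / (2 * n + 2) * ((n + 1) * ‖g‖) = (n + 1 / 2) * ‖g‖ := by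
      field_simp
    rw [this]
    linarith

theorem exists_universal (n : ℕ) : ∃ φ : Fin (2 * n + 1) → Fin n → C(I, ℝ),
    ∀ f : C(Fin n → I, ℝ), ∃ α, T φ α = f := by
  classical
  let r : ℝ := (2 * n + 1) / (2 * n + 2)
  have hr0 : 0 ≤ r := by positivity
  have hr1 : r < 1 := by
    simp only [r]; rw [div_lt_one (by positivity)]; linarith
  let Ω : C(Fin n → I, ℝ) → Set (Fin (2 * n + 1) → Fin n → C(I, ℝ)) := fun f =>
    {φ | ∃ α, ‖α‖ ≤ ‖f‖ ∧ ‖f - T φ α‖ < r * ‖f‖}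
  have hopen : ∀ f, IsOpen (Ω f) := by
    intro f
    have : Ω f = ⋃ α, ⋃ (_ : ‖α‖ ≤ ‖f‖), {φ | ‖f - T φ α‖ < r * ‖f‖} := by
      ext φ; simp [Ω]
    rw [this]
    refine isOpen_iUnion fun α => isOpen_iUnion fun _ => ?_
    exact isOpen_lt ((continuous_const.sub (T_cont α)).norm) continuous_const
  let s := TopologicalSpace.denseSeq C(Fin n → I, ℝ)
  have hs : DenseRange s := TopologicalSpace.denseRange_denseSeq _
  have : TopologicalSpace.IsCompletelyPseudoMetrizableSpace
      (Fin (2 * n + 1) → Fin n → C(I, ℝ)) := inferInstance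
  have : BaireSpace (Fin (2 * n + 1) → Fin n → C(I, ℝ)) :=
    BaireSpace.of_completelyPseudoMetrizable
  have hd : Dense (⋂ k : ℕ, if s k = 0 then Set.univ else Ω (s k)) := by
    refine dense_iInter_of_isOpen (fun k => ?_) (fun k => ?_)
    · split_ifs
      · exact isOpen_univ
      · exact hopen _
    · split_ifs with h
      · exact dense_univ
      · exact dense_step n _ h
  obtain ⟨φ, hφ⟩ := hd.nonempty
  refine ⟨φ, ?_⟩
  let η : ℝ := (1 - r) / 4
  have hη : 0 < η := by simp only [η]; linarith
  refine surj_of_approx (T φ) (1 + η) (η + r * (1 + η)) (by positivity) ?_ ?_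
  · simp only [η]; nlinarith
  intro f
  by_cases hf : f = 0
  · exact ⟨0, by simp [hf]⟩
  have hF : 0 < ‖f‖ := norm_pos_iff.2 hf
  obtain ⟨k, hk⟩ := hs.exists_dist_lt f (ε := η * ‖f‖) (by positivity)
  rw [dist_eq_norm] at hk
  have hη1 : η < 1 := by simp only [η]; linarith
  have hk0 : s k ≠ 0 := by
    intro h
    rw [h, sub_zero] at hk
    nlinarith
  have hφk := Set.mem_iInter.1 hφ k
  rw [if_neg hk0] at hφk
  obtain ⟨α, h1, h2⟩ := hφk
  have h3 : ‖s k‖ ≤ (1 + η) * ‖f‖ := by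
    have := norm_sub_norm_le (s k) f
    rw [norm_sub_rev] at this
    linarith
  refine ⟨α, h1.trans h3, ?_⟩
  calc ‖f - T φ α‖ = ‖(f - s k) + (s k - T φ α)‖ := by congr 1; abel
    _ ≤ ‖f - s k‖ + ‖s k - T φ α‖ := norm_add_le _ _
    _ ≤ η * ‖f‖ + r * ((1 + η) * ‖f‖) := by
      gcongr
      exact h2.le.trans (by gcongr)
    _ = _ := by ring

end KA


/-- **Kolmogorov–Arnold representation theorem.** For `n ≥ 2` there are `n(2n+1)` continuous
functions `φ p q : [0,1] → [0,1]` such that every continuous `f : [0,1]^n → ℝ` can be written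
as `f x = Σ_q α_q (Σ_p φ p q (x p))` for suitable continuous `α_q : ℝ → ℝ`. -/
theorem kolmogorov_arnold (n : ℕ) (hn : 2 ≤ n) :
    ∃ φ : Fin n → Fin (2 * n + 1) → ℝ → ℝ,
      (∀ p q, ContinuousOn (φ p q) (Set.Icc 0 1) ∧
        Set.MapsTo (φ p q) (Set.Icc 0 1) (Set.Icc 0 1)) ∧
      ∀ f : (Fin n → ℝ) → ℝ,
        ContinuousOn f (Set.univ.pi fun _ => Set.Icc (0 : ℝ) 1) →
        ∃ α : Fin (2 * n + 1) → ℝ → ℝ, (∀ q, Continuous (α q)) ∧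
          ∀ x : Fin n → ℝ, x ∈ Set.univ.pi (fun _ => Set.Icc (0 : ℝ) 1) →
            f x = ∑ q : Fin (2 * n + 1), α q (∑ p : Fin n, φ p q (x p)) := by
  obtain ⟨φ, hφ⟩ := KA.exists_universal n
  let M : ℝ := ‖φ‖ + 1
  have hM : 0 < M := by positivity
  have hb : ∀ q p t, |φ q p t| ≤ M := fun q p t => by
    have h1 := (φ q p).norm_coe_le_norm t
    have h2 := norm_le_pi_norm (φ q) p
    have h3 := norm_le_pi_norm φ q
    rw [Real.norm_eq_abs] at h1
    simp only [M]; linarith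
  refine ⟨fun p q t => (φ q p (Set.projIcc 0 1 zero_le_one t) + M) / (2 * M), ?_, ?_⟩
  · intro p q
    refine ⟨Continuous.continuousOn ?_, ?_⟩
    · have := continuous_projIcc (a := (0:ℝ)) (b := 1) (h := zero_le_one)
      fun_prop
    · intro t _
      have := abs_le.1 (hb q p (Set.projIcc 0 1 zero_le_one t))
      constructor
      · apply div_nonneg <;> linarith
      · rw [div_le_one (by positivity)]; linarith
  · intro f hf
    let f' : C(Fin n → unitInterval, ℝ) := ⟨fun x => f (fun p => (x p : ℝ)),
      hf.comp_continuous (by fun_prop) (fun x p _ => (x p).2)⟩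
    obtain ⟨α, hα⟩ := hφ f'
    refine ⟨fun q t => α q (2 * M * t - n * M), fun q => by fun_prop, ?_⟩
    intro x hx
    let x' : Fin n → unitInterval := fun p => ⟨x p, hx p trivial⟩
    have h1 := congrArg (fun h => h x') hα
    simp only [KA.T_apply] at h1
    have h2 : f' x' = f x := rfl
    rw [← h2, ← h1]
    refine Finset.sum_congr rfl fun q _ => ?_
    congr 1
    have h3 : ∀ p, Set.projIcc 0 1 zero_le_one (x p) = x' p := fun p =>
      Set.projIcc_of_mem _ (hx p trivial)
    simp only [h3]
    rw [← Finset.sum_div, Finset.sum_add_distrib]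
    simp only [Finset.sum_const, Finset.card_univ, Fintype.card_fin, nsmul_eq_mul]
    field_simp
    ring
end
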